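/- arXiv:2311.12231 — 4 statements merged into one kernel-verified Lean document; each statement's English description precedes it below -/
import Mathlib

section
/- Let B be the unit ball of a Minkowski norm on an n-dimensional real vector space V and let 𝒰 ⊂ Gr_k V (2 ≤ k < n) be a nonempty connected open set. Suppose that for every X ∈ 𝒰 at least one of the following holds: (1) B is locally cylindrical near X; (2) B ∩ X is a 0-centered ellipsoid. Then there exists a set B' ⊂ V such that B ∩ X = B' ∩ X for all X ∈ 𝒰 and either B' is a k-cylinder or B' = {v ∈ V : Q(v) ≤ 1} for some nonnegative definite quadratic form Q on V. -/
open Module Set Pointwise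

/-- The Grassmannian of `k`-dimensional linear subspaces of `V`. -/
abbrev Gr (k : ℕ) (V : Type*) [AddCommGroup V] [Module ℝ V] :=
  {X : Submodule ℝ V // Module.finrank ℝ X = k}

/-- The standard (quotient) topology on the Grassmannian, coinduced from the space of
linearly independent `k`-tuples of vectors. -/
noncomputable instance grTop (k : ℕ) (V : Type*) [AddCommGroup V] [Module ℝ V]
    [TopologicalSpace V] : TopologicalSpace (Gr k V) :=
  TopologicalSpace.coinduced
    (fun v : {v : Fin k → V // LinearIndependent ℝ v} =>
      (⟨Submodule.span ℝ (Set.range v.1), by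
          rw [finrank_span_eq_card v.2, Fintype.card_fin]⟩ : Gr k V))
    inferInstance

/-- A convex body: a compact convex set with nonempty interior. -/
def IsConvexBody {V : Type*} [AddCommGroup V] [Module ℝ V] [TopologicalSpace V]
    (B : Set V) : Prop :=
  IsCompact B ∧ Convex ℝ B ∧ (interior B).Nonempty

/-- `C` is a `k`-cylinder with base `K` lying in the `k`-dimensional subspace `X`:
`K` is a `k`-dimensional convex body in `X` and `C = K + Y` for some complement `Y` of `X`. -/
def IsCylinderWithBase {V : Type*} [AddCommGroup V] [Module ℝ V] [TopologicalSpace V]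
    (k : ℕ) (C K : Set V) (X : Submodule ℝ V) : Prop :=
  Module.finrank ℝ X = k ∧ K ⊆ (X : Set V) ∧ IsCompact K ∧ Convex ℝ K ∧
    (interior ((↑) ⁻¹' K : Set X)).Nonempty ∧
    ∃ Y : Submodule ℝ V, IsCompl X Y ∧ C = K + (Y : Set V)

/-- `C` is a `k`-cylinder. -/
def IsCylinder {V : Type*} [AddCommGroup V] [Module ℝ V] [TopologicalSpace V]
    (k : ℕ) (C : Set V) : Prop :=
  ∃ (K : Set V) (X : Submodule ℝ V), IsCylinderWithBase k C K X

/-- Two sets coincide near a subspace `X`. -/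
def CoincideNear {V : Type*} [AddCommGroup V] [Module ℝ V] [TopologicalSpace V]
    (B₁ B₂ : Set V) (X : Submodule ℝ V) : Prop :=
  ∃ U : Set V, IsOpen U ∧ (X : Set V) ⊆ U ∧ B₁ ∩ U = B₂ ∩ U

/-- `B` is locally cylindrical near `X`. -/
def IsLocallyCylindricalNear {V : Type*} [AddCommGroup V] [Module ℝ V] [TopologicalSpace V]
    (k : ℕ) (B : Set V) (X : Submodule ℝ V) : Prop :=
  ∃ C : Set V, IsCylinder k C ∧ CoincideNear B C X

/-- A Minkowski seminorm: nonnegative, positively 1-homogeneous and subadditive. -/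
def IsMinkowskiSeminorm {V : Type*} [AddCommGroup V] [Module ℝ V] (Φ : V → ℝ) : Prop :=
  (∀ v, 0 ≤ Φ v) ∧ (∀ (c : ℝ) (v : V), 0 ≤ c → Φ (c • v) = c * Φ v) ∧
    ∀ v w, Φ (v + w) ≤ Φ v + Φ w

/-- A Minkowski norm: a Minkowski seminorm positive outside the origin. -/
def IsMinkowskiNorm {V : Type*} [AddCommGroup V] [Module ℝ V] (Φ : V → ℝ) : Prop :=
  IsMinkowskiSeminorm Φ ∧ ∀ v : V, v ≠ 0 → 0 < Φ v

/-- `X` is `Φ`-contracting with contracting direction `Y`. -/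
def IsContractingWithDirection {V : Type*} [AddCommGroup V] [Module ℝ V]
    (Φ : V → ℝ) (X Y : Submodule ℝ V) : Prop :=
  ∃ h : IsCompl X Y, ∀ v : V, Φ (X.linearProjOfIsCompl Y h v : V) ≤ Φ v

/-- `X` is `Φ`-contracting: there is a linear projector of `V` onto `X`
that does not increase `Φ`. -/
def IsContracting {V : Type*} [AddCommGroup V] [Module ℝ V]
    (Φ : V → ℝ) (X : Submodule ℝ V) : Prop :=
  ∃ P : V →ₗ[ℝ] V, P ∘ₗ P = P ∧ LinearMap.range P = X ∧ ∀ v, Φ (P v) ≤ Φ v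

/-- `K` is a 0-centered ellipsoid in the subspace `X`: the unit ball of an
inner product norm on `X`. -/
def IsEllipsoidIn {V : Type*} [AddCommGroup V] [Module ℝ V]
    (X : Submodule ℝ V) (K : Set V) : Prop :=
  ∃ Q : QuadraticForm ℝ X, Q.PosDef ∧ K = (↑) '' {x : X | Q x ≤ 1}

namespace RT

open Filter Topology

/-- degree two positive homogeneity -/
def Hom2 {V : Type*} [AddCommGroup V] [Module ℝ V] (F : V → ℝ) : Prop :=
  ∀ (c : ℝ) (v : V), 0 < c → F (c • v) = c ^ 2 * F v

/-- `F` and `G` agree near every nonzero point of `X` -/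
def Germ {V : Type*} [NormedAddCommGroup V] [NormedSpace ℝ V] (F G : V → ℝ)
    (X : Submodule ℝ V) : Prop :=
  ∀ x ∈ X, x ≠ 0 → ∀ᶠ v in 𝓝 x, F v = G v

/-- the span of a frame -/
def mkG {V : Type*} [NormedAddCommGroup V] [NormedSpace ℝ V] {k : ℕ}
    (v : {v : Fin k → V // LinearIndependent ℝ v}) : Gr k V :=
  ⟨Submodule.span ℝ (Set.range v.1), by
          rw [finrank_span_eq_card v.2, Fintype.card_fin]⟩

set_option linter.unusedSectionVars false

section
variable {V : Type*} [NormedAddCommGroup V] [NormedSpace ℝ V] [FiniteDimensional ℝ V] {k : ℕ}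

lemma exists_frame (X : Gr k V) : ∃ e : {v : Fin k → V // LinearIndependent ℝ v}, mkG e = X := by
  obtain ⟨X, hX⟩ := X
  let b := Module.finBasisOfFinrankEq ℝ X hX
  refine ⟨⟨fun i => (b i : V), ?_⟩, ?_⟩
  · exact b.linearIndependent.map' X.subtype (Submodule.ker_subtype X)
  · apply Subtype.ext
    change Submodule.span ℝ (Set.range fun i => (b i : V)) = X
    have : (Set.range fun i => (b i : V)) = X.subtype '' (Set.range b) := by
      rw [← Set.range_comp]; rfl
    rw [this, Submodule.span_image, b.span_eq, Submodule.map_top, Submodule.range_subtype]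

lemma isOpen_gr {S : Set (Gr k V)} : IsOpen S ↔ IsOpen ((mkG (V := V) (k := k)) ⁻¹' S) :=
  isOpen_coinduced

lemma eventually_frame {S : Set (Gr k V)} (hS : IsOpen S)
    (e : {v : Fin k → V // LinearIndependent ℝ v}) (he : mkG e ∈ S) :
    ∀ᶠ e' in 𝓝 e.1, ∃ h : LinearIndependent ℝ e', mkG ⟨e', h⟩ ∈ S := by
  have h1 : IsOpen (Subtype.val '' ((mkG (V := V) (k := k)) ⁻¹' S)) :=
    (isOpen_setOfPred_linearIndependent (𝕜 := ℝ)).isOpenMap_subtype_val _ (isOpen_gr.1 hS)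
  filter_upwards [h1.mem_nhds ⟨e, he, rfl⟩] with e' he'
  obtain ⟨e'', h, rfl⟩ := he'
  exact ⟨e''.2, h⟩

lemma mem_mkG (e : {v : Fin k → V // LinearIndependent ℝ v}) (x : V) :
    x ∈ (mkG e).1 ↔ ∃ a : Fin k → ℝ, ∑ i, a i • e.1 i = x :=
  Submodule.mem_span_range_iff_exists_fun ℝ

lemma isOpen_hit {W : Set V} (hW : IsOpen W) : IsOpen {X : Gr k V | ∃ x ∈ X.1, x ∈ W} := by
  rw [isOpen_gr]
  have : ((mkG (V := V) (k := k)) ⁻¹' {X : Gr k V | ∃ x ∈ X.1, x ∈ W}) =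
      ⋃ a : Fin k → ℝ, {e | ∑ i, a i • e.1 i ∈ W} := by
    ext e
    simp only [Set.mem_preimage, Set.mem_ofPred_eq, Set.mem_iUnion, mem_mkG]
    constructor
    · rintro ⟨x, ⟨a, rfl⟩, hx⟩; exact ⟨a, hx⟩
    · rintro ⟨a, ha⟩; exact ⟨_, ⟨a, rfl⟩, ha⟩
  rw [this]
  refine isOpen_iUnion fun a => hW.preimage ?_
  exact continuous_finsetSum _ fun i _ =>
    continuous_const.smul ((continuous_apply i).comp continuous_subtype_val)

lemma isOpen_germ {F G : V → ℝ} (hF : Hom2 F) (hG : Hom2 G) :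
    IsOpen {X : Gr k V | Germ F G X.1} := by
  have hO : IsOpen {v : V | ∀ᶠ w in 𝓝 v, F w = G w} := isOpen_setOfPred_eventually_nhds
  have hcone : ∀ (c : ℝ) (v : V), 0 < c → (∀ᶠ w in 𝓝 v, F w = G w) →
      ∀ᶠ w in 𝓝 (c • v), F w = G w := by
    intro c v hc h
    have ht : Tendsto (fun w : V => c⁻¹ • w) (𝓝 (c • v)) (𝓝 v) := by
      have : Continuous (fun w : V => c⁻¹ • w) := by fun_prop
      have := this.tendsto (c • v)
      rwa [inv_smul_smul₀ hc.ne'] at this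
    filter_upwards [ht.eventually h] with w hw
    have h1 := hF c (c⁻¹ • w) hc
    have h2 := hG c (c⁻¹ • w) hc
    rw [smul_inv_smul₀ hc.ne'] at h1 h2
    rw [h1, h2, hw]
  rw [isOpen_gr, isOpen_iff_mem_nhds]
  intro e he
  have key : ∀ᶠ e' : {v : Fin k → V // LinearIndependent ℝ v} in 𝓝 e,
      ∀ a ∈ Metric.sphere (0 : Fin k → ℝ) 1,
        ∑ i, a i • e'.1 i ∈ {v : V | ∀ᶠ w in 𝓝 v, F w = G w} := by
    apply (isCompact_sphere (0 : Fin k → ℝ) 1).eventually_forall_of_forall_eventually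
    intro a ha
    have hc : Continuous (fun z : {v : Fin k → V // LinearIndependent ℝ v} × (Fin k → ℝ) =>
      ∑ i, z.2 i • z.1.1 i) :=
      continuous_finsetSum _ fun i _ => ((continuous_apply i).comp continuous_snd).smul
        ((continuous_apply i).comp (continuous_subtype_val.comp continuous_fst))
    refine (hc.tendsto (e, a)).eventually (hO.mem_nhds ?_)
    refine he _ ((mem_mkG e _).2 ⟨a, rfl⟩) ?_
    intro h0
    have := Fintype.linearIndependent_iff.1 e.2 a h0
    have : a = 0 := funext this
    subst this
    simp at ha
  filter_upwards [key] with e' he'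
  intro x hx hx0
  obtain ⟨a, rfl⟩ := (mem_mkG e' x).1 hx
  have ha : a ≠ 0 := by
    rintro rfl; simp at hx0
  have hn : 0 < ‖a‖ := norm_pos_iff.2 ha
  have := he' (‖a‖⁻¹ • a) (by simp [norm_smul, hn.ne'])
  have := hcone ‖a‖ _ hn this
  convert this using 2
  rw [Finset.smul_sum]
  congr 1; ext i
  simp [smul_smul, hn.ne']

lemma propagate {F G : V → ℝ} (hF : Hom2 F) (hG : Hom2 G) {U : Set (Gr k V)}
    (hU : IsPreconnected U) (X₀ : Gr k V) (h₀ : X₀ ∈ U) (hg : Germ F G X₀.1)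
    (hcl : ∀ X ∈ U, ∃ N : Set (Gr k V), IsOpen N ∧ X ∈ N ∧
      ((∃ X' ∈ N, X' ∈ U ∧ Germ F G X'.1) → Germ F G X.1)) :
    ∀ X ∈ U, Germ F G X.1 := by
  by_contra! hcon
  obtain ⟨X₁, h₁, hn₁⟩ := hcon
  choose! N hN hXN hc using hcl
  have hT : IsOpen (⋃ X ∈ {X | X ∈ U ∧ ¬ Germ F G X.1}, N X) :=
    isOpen_biUnion fun X hX => hN X hX.1
  obtain ⟨Z, hZU, hZ1, hZ2⟩ := hU _ _ (isOpen_germ (k := k) hF hG) hT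
    (fun X hX => by
      by_cases h : Germ F G X.1
      · exact Or.inl h
      · exact Or.inr (Set.mem_biUnion (show X ∈ {X | X ∈ U ∧ ¬ Germ F G X.1} from ⟨hX, h⟩)
          (hXN X hX)))
    ⟨X₀, h₀, hg⟩ ⟨X₁, h₁, Set.mem_biUnion (show X₁ ∈ {X | X ∈ U ∧ ¬ Germ F G X.1} from ⟨h₁, hn₁⟩)
          (hXN X₁ h₁)⟩
  simp only [Set.mem_iUnion] at hZ2
  obtain ⟨X, hX, hZX⟩ := hZ2
  exact hX.2 (hc X hX.1 ⟨Z, hZX, hZU, hZ1⟩)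

/-! quadratic part -/

lemma quad_unique (Q Q' : QuadraticForm ℝ V) (x : V) (h : ∀ᶠ v in 𝓝 x, Q v = Q' v) : Q = Q' := by
  ext v
  have hp : Tendsto (fun t : ℝ => x + t • v) (𝓝 0) (𝓝 x) := by
    have : Continuous (fun t : ℝ => x + t • v) := by fun_prop
    simpa using this.tendsto 0
  have hm : Tendsto (fun t : ℝ => x + (-t) • v) (𝓝 0) (𝓝 x) := by
    have : Continuous (fun t : ℝ => x + (-t) • v) := by fun_prop
    simpa using this.tendsto 0
  have hh := ((hp.eventually h).and (hm.eventually h)).filter_mono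
    (nhdsWithin_le_nhds (a := (0:ℝ)) (s := {0}ᶜ))
  obtain ⟨t, ⟨h1, h2⟩, ht⟩ := (hh.and self_mem_nhdsWithin).exists
  have h3 := h.self_of_nhds
  have ht : t ≠ 0 := ht
  have e : ∀ (Q : QuadraticForm ℝ V) (s : ℝ),
      Q (x + s • v) = Q x + s ^ 2 * Q v + s * QuadraticMap.polar Q x v := by
    intro Q s
    rw [QuadraticMap.map_add Q, QuadraticMap.map_smul, QuadraticMap.polar_smul_right]
    simp only [smul_eq_mul]; ring
  rw [e, e] at h1 h2
  have : t ^ 2 * (Q v - Q' v) = 0 := by linarith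
  have := (mul_eq_zero.1 this).resolve_left (pow_ne_zero 2 ht)
  linarith

/-- From the parallelogram law on a product of two open cones to a quadratic form. -/
lemma quad_of_cones {F : V → ℝ} (hF : Hom2 F) (hFc : Continuous F) {C C' : Set V}
    (hC : IsOpen C) (hC' : IsOpen C') (hCc : ∀ (c : ℝ), 0 < c → ∀ v ∈ C, c • v ∈ C)
    (hCc' : ∀ (c : ℝ), 0 < c → ∀ v ∈ C', c • v ∈ C') {x x' : V} (hx : x ∈ C) (hx' : x' ∈ C')
    (hP : ∀ u ∈ C, ∀ w ∈ C', F (u + w) + F (u - w) = 2 * F u + 2 * F w) :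
    ∃ Q : QuadraticForm ℝ V, (∀ u ∈ C, F u = Q u) ∧ ∀ w ∈ C', F w = Q w := by
  let D : V → V → V → ℝ := fun g h u => F (u + g + h) - F (u + g) - F (u + h) + F u
  have hD : ∀ g h u w, u ∈ C → u + g ∈ C → u + h ∈ C → u + g + h ∈ C →
      w ∈ C' → w + g ∈ C' → w + h ∈ C' → w + g + h ∈ C' → D g h u = D g h w := by
    intro g h u w u1 u2 u3 u4 w1 w2 w3 w4
    have a1 := hP _ u2 _ w1
    have a2 := hP _ u4 _ w3
    have a3 := hP _ u1 _ w2
    have a4 := hP _ u3 _ w4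
    have e1 : u + g + h - (w + h) = u + g - w := by abel
    have e2 : u + g + h + (w + h) = u + (w + g) + h + h := by abel
    have e3 : u + h - (w + g + h) = u - (w + g) := by abel
    have e4 : u + h + (w + g + h) = u + (w + g) + h + h := by abel
    have e5 : u + g + w = u + (w + g) := by abel
    rw [e1, e2] at a2
    rw [e3, e4] at a4
    rw [e5] at a1
    simp only [D]
    linarith
  have hev : ∀ (C : Set V) (x : V), IsOpen C → (∀ (c : ℝ), 0 < c → ∀ v ∈ C, c • v ∈ C) → x ∈ C →
      ∀ z : V, ∀ᶠ R : ℝ in atTop, R • x + z ∈ C := by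
    intro C x hC hCc hx z
    have : Tendsto (fun R : ℝ => x + R⁻¹ • z) atTop (𝓝 x) := by
      have h1 : Tendsto (fun R : ℝ => R⁻¹ • z) atTop (𝓝 ((0:ℝ) • z)) :=
        tendsto_inv_atTop_zero.smul_const z
      simpa using tendsto_const_nhds.add h1
    filter_upwards [this.eventually (hC.mem_nhds hx), eventually_gt_atTop 0] with R hR hR0
    have := hCc R hR0 _ hR
    rwa [smul_add, smul_inv_smul₀ hR0.ne'] at this
  have hevx := hev C x hC hCc hx
  have hevx' := hev C' x' hC' hCc' hx'
  have hex : ∀ g h : V, ∃ K : ℝ, (∀ u, u ∈ C → u + g ∈ C → u + h ∈ C → u + g + h ∈ C → D g h u = K) ∧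
      (∀ w, w ∈ C' → w + g ∈ C' → w + h ∈ C' → w + g + h ∈ C' → D g h w = K) := by
    intro g h
    obtain ⟨R, ⟨⟨⟨r1, r2⟩, r3⟩, r4⟩⟩ :=
      (((hevx 0).and (hevx g)).and (hevx h)).and (hevx (g + h)) |>.exists
    obtain ⟨R', ⟨⟨⟨s1, s2⟩, s3⟩, s4⟩⟩ :=
      (((hevx' 0).and (hevx' g)).and (hevx' h)).and (hevx' (g + h)) |>.exists
    rw [add_zero] at r1 s1
    rw [← add_assoc] at r4 s4
    refine ⟨D g h (R • x), ?_, ?_⟩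
    · intro u u1 u2 u3 u4
      rw [hD g h u (R' • x') u1 u2 u3 u4 s1 s2 s3 s4, hD g h (R • x) (R' • x') r1 r2 r3 r4 s1 s2 s3 s4]
    · intro w w1 w2 w3 w4
      rw [hD g h (R • x) w r1 r2 r3 r4 w1 w2 w3 w4]
  choose K hK hK' using hex
  have hsymm : ∀ g h, K g h = K h g := by
    intro g h
    obtain ⟨R, ⟨⟨⟨r1, r2⟩, r3⟩, r4⟩⟩ :=
      (((hevx 0).and (hevx g)).and (hevx h)).and (hevx (g + h)) |>.exists
    rw [add_zero] at r1
    rw [← add_assoc] at r4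
    have r5 := r4
    rw [add_right_comm] at r5
    rw [← hK g h _ r1 r2 r3 r4, ← hK h g _ r1 r3 r2 r5]
    simp only [D]
    rw [add_right_comm (R • x) g h]; ring
  have hadd : ∀ h g g', K (g + g') h = K g h + K g' h := by
    intro h g g'
    obtain ⟨R, ⟨⟨⟨⟨⟨⟨⟨r1, r2⟩, r3⟩, r4⟩, r5⟩, r6⟩, r7⟩, r8⟩⟩ :=
      (((((((hevx 0).and (hevx g)).and (hevx g')).and (hevx h)).and (hevx (g + g'))).and
        (hevx (g + h))).and (hevx (g' + h))).and (hevx (g + g' + h)) |>.exists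
    rw [add_zero] at r1
    have q1 : R • x + (g + g') + h ∈ C := by rw [add_assoc]; exact r8
    have q2 : R • x + g' + g ∈ C := by convert r5 using 1; abel
    have q3 : R • x + g' + h ∈ C := by convert r7 using 1; abel
    have q4 : R • x + g' + g + h ∈ C := by convert r8 using 1; abel
    rw [← hK (g + g') h _ r1 r5 r4 q1, ← hK g h _ r3 q2 q3 q4, ← hK g' h _ r1 r3 r4 q3]
    simp only [D]
    rw [show R • x + (g + g') = R • x + g' + g by abel]
    ring
  let A : V → V →+ ℝ := fun h => AddMonoidHom.mk' (fun g => K g h) (hadd h)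
  have hAc : ∀ h, Continuous (A h) := by
    intro h
    apply continuous_of_continuousAt_zero
    obtain ⟨R, r1, r2⟩ := ((hevx 0).and (hevx h)).exists
    rw [add_zero] at r1
    have ev : ∀ᶠ g in 𝓝 (0 : V), D g h (R • x) = A h g := by
      have c1 : ContinuousAt (fun g : V => R • x + g) 0 := by fun_prop
      have c2 : ContinuousAt (fun g : V => R • x + g + h) 0 := by fun_prop
      filter_upwards [c1.eventually_mem (hC.mem_nhds (by simpa using r1)),
        c2.eventually_mem (hC.mem_nhds (by simpa using r2))] with g h1 h2
      exact hK g h _ r1 h1 r2 h2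
    refine ContinuousAt.congr ?_ ev
    apply Continuous.continuousAt
    simp only [D]
    fun_prop
  let L : V → V →L[ℝ] ℝ := fun h => (A h).toRealLinearMap (hAc h)
  have hL : ∀ g h, L h g = K g h := fun g h => rfl
  let Bl : V →ₗ[ℝ] V →ₗ[ℝ] ℝ := LinearMap.mk₂ ℝ (fun h g => L h g)
    (by intro a b c; rw [hL, hL, hL, hsymm, hadd, hsymm a, hsymm b])
    (by intro c a b; rw [hL, hL, hsymm, ← hL, map_smul, hL, hsymm])
    (by intro a b c; simp) (by intro a b c; simp)
  have hval : ∀ C : Set V, (∀ (c : ℝ), 0 < c → ∀ v ∈ C, c • v ∈ C) → ∀ u ∈ C,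
      (u ∈ C → u + u ∈ C → u + u ∈ C → u + u + u ∈ C → D u u u = K u u) →
      F u = (2⁻¹ : ℝ) * K u u := by
    intro C hCc u hu h
    have e2 : u + u = (2 : ℝ) • u := by module
    have e3 : u + u + u = (3 : ℝ) • u := by module
    have := h hu (by rw [e2]; exact hCc 2 (by norm_num) u hu)
      (by rw [e2]; exact hCc 2 (by norm_num) u hu) (by rw [e3]; exact hCc 3 (by norm_num) u hu)
    simp only [D] at this
    rw [e3, e2, hF 2 u (by norm_num), hF 3 u (by norm_num)] at this
    linarith
  refine ⟨(2⁻¹ : ℝ) • LinearMap.BilinMap.toQuadraticMap Bl, ?_, ?_⟩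
  · intro u hu
    simpa [Bl, hL] using hval C hCc u hu (hK u u u)
  · intro u hu
    simpa [Bl, hL] using hval C' hCc' u hu (hK' u u u)


lemma norm_continuous {Φ : V → ℝ} (hΦ : IsMinkowskiNorm Φ) : Continuous Φ := by
  have hc : ConvexOn ℝ univ Φ := by
    refine ⟨convex_univ, ?_⟩
    intro x _ y _ a b ha hb _
    have := hΦ.1.2.2 (a • x) (b • y)
    rw [hΦ.1.2.1 a x ha, hΦ.1.2.1 b y hb] at this
    simpa using this
  exact hc.locallyLipschitz.continuous

lemma norm_zero' {Φ : V → ℝ} (hΦ : IsMinkowskiNorm Φ) : Φ 0 = 0 := by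
  have := hΦ.1.2.1 0 0 le_rfl
  simpa using this

lemma hom2_sq {Φ : V → ℝ} (hΦ : IsMinkowskiNorm Φ) : Hom2 (fun v => Φ v ^ 2) := by
  intro c v hc
  simp only [hΦ.1.2.1 c v hc.le]; ring

lemma hom2_sq_comp {Φ : V → ℝ} (hΦ : IsMinkowskiNorm Φ) (P : V →ₗ[ℝ] V) :
    Hom2 (fun v => Φ (P v) ^ 2) := by
  intro c v hc
  simp only [map_smul, hΦ.1.2.1 c _ hc.le]; ring

lemma hom2_quad (Q : QuadraticForm ℝ V) : Hom2 Q := by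
  intro c v hc
  rw [QuadraticMap.map_smul, smul_eq_mul]; ring

lemma ellipsoid_iff {Φ : V → ℝ} (hΦ : IsMinkowskiNorm Φ) (X : Submodule ℝ V) :
    IsEllipsoidIn X ({v | Φ v ≤ 1} ∩ (X : Set V)) ↔
      ∃ Q : QuadraticForm ℝ X, ∀ x : X, Φ x ^ 2 = Q x := by
  constructor
  · rintro ⟨Q, hQ, hK⟩
    refine ⟨Q, ?_⟩
    have hiff : ∀ x : X, Φ x ≤ 1 ↔ Q x ≤ 1 := by
      intro x
      have : (x : V) ∈ ({v | Φ v ≤ 1} ∩ (X : Set V)) ↔ Q x ≤ 1 := by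
        rw [hK]
        constructor
        · rintro ⟨y, hy, hyx⟩
          have : y = x := Subtype.ext hyx
          rw [← this]; exact hy
        · intro h; exact ⟨x, h, rfl⟩
      rw [← this]
      exact ⟨fun h => ⟨h, x.2⟩, fun h => h.1⟩
    have hsc : ∀ (s : ℝ) (x : X), 0 < s → (s * Φ x ≤ 1 ↔ s * s * Q x ≤ 1) := by
      intro s x hs
      have := hiff (s • x)
      rwa [QuadraticMap.map_smul, smul_eq_mul, Submodule.coe_smul, hΦ.1.2.1 s _ hs.le] at this
    intro x
    by_cases hx : x = 0
    · subst hx; simp [norm_zero' hΦ]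
    have hp : 0 < Φ x := hΦ.2 x (by simpa using hx)
    have hq : 0 < Q x := hQ x hx
    apply le_antisymm
    · have hs : 0 < √(Q x) := Real.sqrt_pos.2 hq
      have h1 := (hsc (√(Q x))⁻¹ x (inv_pos.2 hs)).2 (by
        rw [← mul_inv, Real.mul_self_sqrt hq.le, inv_mul_cancel₀ hq.ne'])
      rw [inv_mul_le_iff₀ hs, mul_one] at h1
      calc Φ x ^ 2 ≤ √(Q x) ^ 2 := by gcongr
        _ = Q x := Real.sq_sqrt hq.le
    · have h1 := (hsc (Φ x)⁻¹ x (inv_pos.2 hp)).1 (by rw [inv_mul_cancel₀ hp.ne'])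
      rw [← mul_inv, inv_mul_le_iff₀ (by positivity)] at h1
      linarith
  · rintro ⟨Q, hQ⟩
    refine ⟨Q, ?_, ?_⟩
    · intro x hx
      rw [← hQ]
      have := hΦ.2 x (by simpa using hx)
      positivity
    · ext v
      constructor
      · rintro ⟨h1, h2⟩
        refine ⟨⟨v, h2⟩, ?_, rfl⟩
        change Q ⟨v, h2⟩ ≤ 1
        rw [← hQ]
        exact pow_le_one₀ (hΦ.1.1 _) h1
      · rintro ⟨x, hx, rfl⟩
        refine ⟨?_, x.2⟩
        have hx : Q x ≤ 1 := hx
        rw [← hQ] at hx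
        change Φ x ≤ 1
        nlinarith [hΦ.1.1 x]

lemma pair_local {Φ : V → ℝ} (hΦ : IsMinkowskiNorm Φ) {U : Set (Gr k V)} (hU : IsOpen U)
    (hE : ∀ X ∈ U, ∃ Q : QuadraticForm ℝ X.1, ∀ x : X.1, Φ x ^ 2 = Q x)
    (X : Gr k V) (hX : X ∈ U) (x x' : V) (hx : x ∈ X.1) (hx' : x' ∈ X.1)
    (hli : LinearIndependent ℝ ![x, x']) :
    ∃ Q : QuadraticForm ℝ V, (∀ᶠ v in 𝓝 x, Φ v ^ 2 = Q v) ∧ (∀ᶠ v in 𝓝 x', Φ v ^ 2 = Q v) := by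
  obtain ⟨e, rfl⟩ := exists_frame X
  obtain ⟨T, hT⟩ := LinearMap.exists_leftInverse_of_injective
    (Fintype.linearCombination ℝ ![x, x']) (by
      rw [LinearMap.ker_eq_bot]
      exact hli.fintypeLinearCombination_injective)
  have hTx : T x = Pi.single 0 1 := by
    have := LinearMap.congr_fun hT (Pi.single 0 1)
    simpa [Fintype.linearCombination_apply_single] using this
  have hTx' : T x' = Pi.single 1 1 := by
    have := LinearMap.congr_fun hT (Pi.single 1 1)
    simpa [Fintype.linearCombination_apply_single] using this
  have hcont : Continuous (fun p : V × V => fun i : Fin k =>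
      e.1 i + T (e.1 i) 0 • (p.1 - x) + T (e.1 i) 1 • (p.2 - x')) := by
    apply continuous_pi
    intro i
    fun_prop
  have hev : ∀ᶠ p in 𝓝 (x, x'), ∃ X' ∈ U, p.1 ∈ X'.1 ∧ p.2 ∈ X'.1 := by
    have h0 := hcont.tendsto (x, x')
    simp only [sub_self, smul_zero, add_zero] at h0
    filter_upwards [h0.eventually (eventually_frame hU e hX)] with p hp
    obtain ⟨hl, hp⟩ := hp
    have hgen : ∀ z ∈ (mkG e).1, z + T z 0 • (p.1 - x) + T z 1 • (p.2 - x') ∈ (mkG ⟨_, hl⟩).1 := by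
      intro z hz
      obtain ⟨a, rfl⟩ := (mem_mkG e z).1 hz
      rw [mem_mkG]
      refine ⟨a, ?_⟩
      simp only [smul_add, Finset.sum_add_distrib, map_sum, map_smul, Finset.sum_apply,
        Pi.smul_apply, Finset.sum_smul, smul_eq_mul, mul_smul]
    refine ⟨_, hp, ?_, ?_⟩
    · have := hgen x hx
      simpa [hTx] using this
    · have := hgen x' hx'
      simpa [hTx'] using this
  obtain ⟨N, N', hN, hxN, hN', hxN', hNN⟩ := mem_nhds_prod_iff'.1 hev
  let cone : Set V → Set V := fun N => ⋃ c : {c : ℝ // 0 < c}, {v | c.1 • v ∈ N}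
  have cone_open : ∀ N, IsOpen N → IsOpen (cone N) := fun N hN =>
    isOpen_iUnion fun c => hN.preimage (continuous_const_smul c.1)
  have cone_cone : ∀ N (c : ℝ), 0 < c → ∀ v ∈ cone N, c • v ∈ cone N := by
    intro N c hc v hv
    obtain ⟨d, hd⟩ := Set.mem_iUnion.1 hv
    refine Set.mem_iUnion.2 ⟨⟨d.1 / c, div_pos d.2 hc⟩, ?_⟩
    change (d.1 / c) • c • v ∈ N
    rw [smul_smul, div_mul_cancel₀ _ hc.ne']
    exact hd
  have cone_self : ∀ N, N ⊆ cone N := by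
    intro N v hv
    refine Set.mem_iUnion.2 ⟨⟨1, one_pos⟩, ?_⟩
    change (1 : ℝ) • v ∈ N
    rwa [one_smul]
  obtain ⟨Q, hQ1, hQ2⟩ := quad_of_cones (hom2_sq hΦ) ((norm_continuous hΦ).pow 2)
    (cone_open N hN) (cone_open N' hN') (cone_cone N) (cone_cone N')
    (cone_self N hxN) (cone_self N' hxN') (by
      intro u hu w hw
      obtain ⟨c, hc⟩ := Set.mem_iUnion.1 hu
      obtain ⟨d, hd⟩ := Set.mem_iUnion.1 hw
      obtain ⟨X', hX', h1, h2⟩ := hNN (Set.mk_mem_prod hc hd)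
      obtain ⟨q, hq⟩ := hE X' hX'
      have hu' : u ∈ X'.1 := (Submodule.smul_mem_iff _ c.2.ne').1 h1
      have hw' : w ∈ X'.1 := (Submodule.smul_mem_iff _ d.2.ne').1 h2
      have e1 := hq (⟨u, hu'⟩ + ⟨w, hw'⟩)
      have e2 := hq (⟨u, hu'⟩ - ⟨w, hw'⟩)
      have e3 := hq ⟨u, hu'⟩
      have e4 := hq ⟨w, hw'⟩
      have e5 : q (⟨u, hu'⟩ + ⟨w, hw'⟩) = q ⟨u, hu'⟩ + q ⟨w, hw'⟩ +
        QuadraticMap.polar q ⟨u, hu'⟩ ⟨w, hw'⟩ := QuadraticMap.map_add q _ _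
      have e6 : q (⟨u, hu'⟩ - ⟨w, hw'⟩) = q ⟨u, hu'⟩ + q ⟨w, hw'⟩ -
        QuadraticMap.polar q ⟨u, hu'⟩ ⟨w, hw'⟩ := by
        rw [sub_eq_add_neg, QuadraticMap.map_add q, QuadraticMap.map_neg,
          QuadraticMap.polar_neg_right]; ring
      simp only [Submodule.coe_add, Submodule.coe_sub] at e1 e2 e3 e4
      rw [e1, e2, e3, e4, e5, e6]; ring)
  refine ⟨Q, ?_, ?_⟩
  · filter_upwards [hN.mem_nhds hxN] with v hv
    exact hQ1 v (cone_self N hv)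
  · filter_upwards [hN'.mem_nhds hxN'] with v hv
    exact hQ2 v (cone_self N' hv)

lemma quad_local (hk : 2 ≤ k) {Φ : V → ℝ} (hΦ : IsMinkowskiNorm Φ) {U : Set (Gr k V)}
    (hU : IsOpen U)
    (hE : ∀ X ∈ U, ∃ Q : QuadraticForm ℝ X.1, ∀ x : X.1, Φ x ^ 2 = Q x)
    (X : Gr k V) (hX : X ∈ U) :
    ∃ Q : QuadraticForm ℝ V, Germ (fun v => Φ v ^ 2) Q X.1 := by
  have hr : 1 < Module.finrank ℝ X.1 := by rw [X.2]; omega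
  haveI : Nontrivial X.1 := Module.nontrivial_of_finrank_pos (R := ℝ) (by omega)
  obtain ⟨x0, hx0⟩ := exists_ne (0 : X.1)
  obtain ⟨x1, h01⟩ := exists_linearIndependent_pair_of_one_lt_finrank hr hx0
  have hpair : ∀ a b : X.1, LinearIndependent ℝ ![a, b] → LinearIndependent ℝ ![(a : V), (b : V)] := by
    intro a b h
    have := h.map' X.1.subtype (Submodule.ker_subtype _)
    have e : (X.1.subtype ∘ ![a, b] : Fin 2 → V) = ![(a : V), (b : V)] := by
      ext i; fin_cases i <;> rfl
    rwa [e] at this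
  have hx0V : (x0 : V) ≠ 0 := by simpa using hx0
  obtain ⟨Q, hQ0, hQ1⟩ := pair_local hΦ hU hE X hX x0 x1 x0.2 x1.2 (hpair _ _ h01)
  refine ⟨Q, ?_⟩
  intro x hx hxne
  by_cases hl : LinearIndependent ℝ ![(x0 : V), x]
  · obtain ⟨Q', h1, h2⟩ := pair_local hΦ hU hE X hX x0 x x0.2 hx hl
    have : Q = Q' := quad_unique Q Q' x0 (by
      filter_upwards [hQ0, h1] with v a b
      rw [← a, ← b])
    rw [this]; exact h2
  · have hl' : LinearIndependent ℝ ![(x1 : V), x] := by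
      rw [LinearIndependent.pair_iff' hx0V] at hl
      push Not at hl
      obtain ⟨a, ha⟩ := hl
      have hane : a ≠ 0 := by rintro rfl; simp at ha; exact hxne ha.symm
      have h01' := hpair _ _ h01
      rw [LinearIndependent.pair_iff] at h01' ⊢
      intro s t hst
      rw [← ha] at hst
      have := h01' (t * a) s (by rw [← hst, mul_smul]; abel)
      exact ⟨this.2, by simpa [hane] using this.1⟩
    obtain ⟨Q', h1, h2⟩ := pair_local hΦ hU hE X hX x1 x x1.2 hx hl'
    have : Q = Q' := quad_unique Q Q' x1 (by
      filter_upwards [hQ1, h1] with v a b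
      rw [← a, ← b])
    rw [this]; exact h2

lemma quad_nonneg (hk : 2 ≤ k) {Φ : V → ℝ} (hΦ : IsMinkowskiNorm Φ) (X : Gr k V)
    (Q : QuadraticForm ℝ V) (hQ : Germ (fun v => Φ v ^ 2) Q X.1) (v : V) : 0 ≤ Q v := by
  by_contra! hv
  let l : X.1 →ₗ[ℝ] ℝ := (QuadraticMap.polarBilin Q).flip v ∘ₗ X.1.subtype
  have hker : LinearMap.ker l ≠ ⊥ := LinearMap.ker_ne_bot_of_finrank_lt (by
    rw [X.2, Module.finrank_self]; omega)
  obtain ⟨x, hxl, hx0⟩ := (Submodule.ne_bot_iff _).1 hker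
  have hpol : QuadraticMap.polar Q x v = 0 := hxl
  have hxV : (x : V) ≠ 0 := by simpa using hx0
  have h := hQ x x.2 hxV
  have hp : Tendsto (fun t : ℝ => (x : V) + t • v) (𝓝 0) (𝓝 (x : V)) := by
    have : Continuous (fun t : ℝ => (x : V) + t • v) := by fun_prop
    simpa using this.tendsto 0
  have hm : Tendsto (fun t : ℝ => (x : V) + (-t) • v) (𝓝 0) (𝓝 (x : V)) := by
    have : Continuous (fun t : ℝ => (x : V) + (-t) • v) := by fun_prop
    simpa using this.tendsto 0
  have hh := ((hp.eventually h).and (hm.eventually h)).filter_mono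
    (nhdsWithin_le_nhds (a := (0:ℝ)) (s := {0}ᶜ))
  obtain ⟨t, ⟨h1, h2⟩, ht⟩ := (hh.and self_mem_nhdsWithin).exists
  have h3 := h.self_of_nhds
  have ht : t ≠ 0 := ht
  have e : ∀ s : ℝ, Q ((x : V) + s • v) = Q x + s ^ 2 * Q v := by
    intro s
    rw [QuadraticMap.map_add Q, QuadraticMap.map_smul, QuadraticMap.polar_smul_right, hpol]
    simp only [smul_eq_mul]; ring
  simp only [e] at h1 h2 h3
  have ht2 : 0 < t ^ 2 := by positivity
  have hneg : t ^ 2 * Q v < 0 := mul_neg_of_pos_of_neg ht2 hv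
  have l1 : Φ ((x : V) + t • v) < Φ x := by
    apply lt_of_pow_lt_pow_left₀ 2 (hΦ.1.1 _)
    rw [h1, h3]; linarith
  have l2 : Φ ((x : V) + (-t) • v) < Φ x := by
    apply lt_of_pow_lt_pow_left₀ 2 (hΦ.1.1 _)
    rw [h2, h3, neg_sq]; linarith
  have l3 := hΦ.1.2.2 ((x : V) + t • v) ((x : V) + (-t) • v)
  rw [show (x : V) + t • v + ((x : V) + (-t) • v) = (2 : ℝ) • (x : V) by module,
    hΦ.1.2.1 2 _ (by norm_num)] at l3
  linarith

/-! cylinder part -/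

lemma cyl_local {Φ : V → ℝ} (hΦ : IsMinkowskiNorm Φ) (X : Gr k V)
    (h : IsLocallyCylindricalNear k {v | Φ v ≤ 1} X.1) :
    ∃ P : V →ₗ[ℝ] V, (∀ v, P v ∈ X.1) ∧ (∀ x ∈ X.1, P x = x) ∧
      ∀ x ∈ X.1, x ≠ 0 → ∀ᶠ v in 𝓝 x, Φ v = Φ (P v) := by
  obtain ⟨C, ⟨K, X', hX', hKX, -, -, -, Y, hXY, rfl⟩, U, hU, hXU, hBC⟩ := h
  have hiff : ∀ v ∈ U, (Φ v ≤ 1 ↔ v ∈ K + (Y : Set V)) := by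
    intro v hv
    have : v ∈ {v | Φ v ≤ 1} ∩ U ↔ v ∈ (K + (Y : Set V)) ∩ U := by rw [hBC]
    constructor
    · intro h; exact (this.1 ⟨h, hv⟩).1
    · intro h; exact (this.2 ⟨h, hv⟩).1
  have hinv : ∀ v, ∀ y ∈ Y, v ∈ K + (Y : Set V) → v + y ∈ K + (Y : Set V) := by
    rintro _ y hy ⟨a, ha, b, hb, rfl⟩
    exact ⟨a, ha, b + y, Y.add_mem hb hy, by simp only [add_assoc]⟩
  have h0 : (0 : V) ∈ K + (Y : Set V) :=
    (hiff 0 (hXU X.1.zero_mem)).1 (by rw [norm_zero' hΦ]; norm_num)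
  have hdisj : Disjoint X.1 Y := by
    rw [Submodule.disjoint_def]
    intro y hyX hyY
    by_contra hy
    have hp := hΦ.2 y hy
    have := (hiff ((2 / Φ y) • y) (hXU (X.1.smul_mem _ hyX))).2 (by
      have := hinv 0 _ (Y.smul_mem (2 / Φ y) hyY) h0
      rwa [zero_add] at this)
    rw [hΦ.1.2.1 _ _ (by positivity), div_mul_cancel₀ _ hp.ne'] at this
    norm_num at this
  have hdim : Module.finrank ℝ V ≤ Module.finrank ℝ X.1 + Module.finrank ℝ Y := by
    have := Submodule.finrank_add_eq_of_isCompl hXY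
    rw [X.2, ← this, hX']
  have hc : IsCompl X.1 Y := ⟨hdisj, codisjoint_iff.2 (Submodule.eq_top_of_disjoint _ _ hdim hdisj)⟩
  refine ⟨X.1.projection Y hc, Submodule.projection_apply_mem hc, fun x hx =>
    Submodule.projection_apply_of_mem_left hc hx, ?_⟩
  set P := X.1.projection Y hc with hP
  have hPY : ∀ v, v - P v ∈ Y := Submodule.sub_projection_mem hc
  have hCP : ∀ v, v ∈ K + (Y : Set V) ↔ P v ∈ K + (Y : Set V) := by
    intro v
    constructor
    · intro h
      have := hinv v _ (Y.neg_mem (hPY v)) h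
      rwa [neg_sub, add_sub_cancel] at this
    · intro h
      have := hinv (P v) _ (hPY v) h
      rwa [add_sub_cancel] at this
  have hPX : ∀ v, P v ∈ X.1 := Submodule.projection_apply_mem hc
  have hPc : Continuous P := P.continuous_of_finiteDimensional
  have hΦc := norm_continuous hΦ
  intro x hx hx0
  have hxp := hΦ.2 x hx0
  have hPx : P x = x := Submodule.projection_apply_of_mem_left hc hx
  have t1 : ContinuousAt (fun v => (Φ v)⁻¹ • v) x :=
    (hΦc.continuousAt.inv₀ hxp.ne').smul continuousAt_id
  have t2 : ContinuousAt (fun v => (Φ (P v))⁻¹ • v) x :=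
    ((hΦc.comp hPc).continuousAt.inv₀ (by simpa [hPx] using hxp.ne')).smul continuousAt_id
  have p1 : ∀ᶠ v in 𝓝 x, 0 < Φ v := hΦc.continuousAt.eventually (lt_mem_nhds hxp)
  have p2 : ∀ᶠ v in 𝓝 x, 0 < Φ (P v) :=
    (hΦc.comp hPc).continuousAt.eventually (lt_mem_nhds (by simpa [hPx] using hxp))
  filter_upwards [t1.eventually_mem (hU.mem_nhds (hXU (X.1.smul_mem _ hx))),
    t2.eventually_mem (hU.mem_nhds (hXU (X.1.smul_mem _ hx))), p1, p2] with v u1 u2 q1 q2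
  apply le_antisymm
  · have a := (hiff _ (hXU (X.1.smul_mem (Φ (P v))⁻¹ (hPX v)))).1 (by
      rw [hΦ.1.2.1 _ _ (inv_nonneg.2 q2.le), inv_mul_cancel₀ q2.ne'])
    rw [← map_smul, ← hCP, ← hiff _ u2, hΦ.1.2.1 _ _ (inv_nonneg.2 q2.le),
      inv_mul_le_iff₀ q2, mul_one] at a
    exact a
  · have a := (hiff _ u1).1 (by
      rw [hΦ.1.2.1 _ _ (inv_nonneg.2 q1.le), inv_mul_cancel₀ q1.ne'])
    rw [hCP, map_smul, ← hiff _ (hXU (X.1.smul_mem _ (hPX v))), hΦ.1.2.1 _ _ (inv_nonneg.2 q1.le),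
      inv_mul_le_iff₀ q1, mul_one] at a
    exact a

lemma germ_sq_iff {Φ : V → ℝ} (hΦ : IsMinkowskiNorm Φ) (X : Submodule ℝ V) (P : V →ₗ[ℝ] V) :
    Germ (fun v => Φ v ^ 2) (fun v => Φ (P v) ^ 2) X ↔
      ∀ x ∈ X, x ≠ 0 → ∀ᶠ v in 𝓝 x, Φ v = Φ (P v) := by
  have : ∀ v, Φ v ^ 2 = Φ (P v) ^ 2 ↔ Φ v = Φ (P v) := fun v =>
    pow_left_inj₀ (hΦ.1.1 _) (hΦ.1.1 _) two_ne_zero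
  simp only [Germ, this]

lemma ker_le {Φ : V → ℝ} (hΦ : IsMinkowskiNorm Φ) (X X₁ : Gr k V) (P P₀ : V →ₗ[ℝ] V)
    (hP : ∀ v, P v ∈ X₁.1)
    (h : ∀ x ∈ X.1, x ≠ 0 → ∀ᶠ v in 𝓝 x, Φ v = Φ (P v))
    (h₀ : ∀ x ∈ X.1, x ≠ 0 → ∀ᶠ v in 𝓝 x, Φ v = Φ (P₀ v)) :
    LinearMap.ker P₀ ≤ LinearMap.ker P := by
  have hdisj : Disjoint X.1 (LinearMap.ker P) := by
    rw [Submodule.disjoint_def]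
    intro y hyX hyY
    by_contra hy
    have h1 := (h y hyX hy).self_of_nhds
    rw [LinearMap.mem_ker.1 hyY, norm_zero' hΦ] at h1
    exact (hΦ.2 y hy).ne' h1
  have hdim : Module.finrank ℝ V ≤ Module.finrank ℝ X.1 + Module.finrank ℝ (LinearMap.ker P) := by
    have h1 := P.finrank_range_add_finrank_ker
    have h2 : Module.finrank ℝ (LinearMap.range P) ≤ Module.finrank ℝ X₁.1 :=
      Submodule.finrank_mono (by rintro _ ⟨v, rfl⟩; exact hP v)
    rw [X₁.2] at h2
    rw [X.2]; omega
  have htop := Submodule.eq_top_of_disjoint _ _ hdim hdisj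
  intro y hy
  obtain ⟨w, hw, z, hz, rfl⟩ := Submodule.mem_sup.1 (htop ▸ Submodule.mem_top : y ∈ X.1 ⊔ LinearMap.ker P)
  by_cases hw0 : w = 0
  · rw [hw0, zero_add]; exact hz
  exfalso
  have hp : Tendsto (fun t : ℝ => w + t • (w + z)) (𝓝 0) (𝓝 w) := by
    have : Continuous (fun t : ℝ => w + t • (w + z)) := by fun_prop
    simpa using this.tendsto 0
  have hh := ((hp.eventually (h w hw hw0)).and (hp.eventually (h₀ w hw hw0))).filter_mono
    (nhdsWithin_le_nhds (a := (0:ℝ)) (s := Set.Ioi 0))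
  obtain ⟨t, ⟨h1, h2⟩, ht⟩ := (hh.and self_mem_nhdsWithin).exists
  have ht : 0 < t := ht
  have h3 := (h w hw hw0).self_of_nhds
  have h4 := (h₀ w hw hw0).self_of_nhds
  rw [map_add, map_smul, map_add, LinearMap.mem_ker.1 hz, add_zero,
    show P w + t • P w = (1 + t) • P w by module, hΦ.1.2.1 _ _ (by positivity), ← h3] at h1
  rw [map_add, map_smul, LinearMap.mem_ker.1 hy, smul_zero, add_zero, ← h4] at h2
  have := hΦ.2 w hw0
  nlinarith

lemma cyl_final {Φ : V → ℝ} (hΦ : IsMinkowskiNorm Φ) (X : Gr k V) (P : V →ₗ[ℝ] V)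
    (hP : ∀ v, P v ∈ X.1) (hP' : ∀ x ∈ X.1, P x = x) : IsCylinder k {v | Φ (P v) ≤ 1} := by
  have hΦc := norm_continuous hΦ
  refine ⟨{v | Φ v ≤ 1} ∩ (X.1 : Set V), X.1, X.2, Set.inter_subset_right, ?_, ?_, ?_,
    LinearMap.ker P, ?_, ?_⟩
  · apply IsCompact.inter_right _ X.1.closed_of_finiteDimensional
    rcases subsingleton_or_nontrivial V with hV | hV
    · exact (Set.toFinite _).isCompact
    · obtain ⟨s, hs, hmin⟩ := (isCompact_sphere (0 : V) 1).exists_isMinOn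
        (NormedSpace.sphere_nonempty.2 zero_le_one) hΦc.continuousOn
      have hs0 : s ≠ 0 := by rintro rfl; simp at hs
      have hsp := hΦ.2 s hs0
      refine (isCompact_closedBall (0 : V) (Φ s)⁻¹).of_isClosed_subset
        (isClosed_le hΦc continuous_const) ?_
      intro v hv
      have hv : Φ v ≤ 1 := hv
      rw [mem_closedBall_zero_iff]
      by_cases hv0 : v = 0
      · subst hv0; rw [norm_zero]; positivity
      have hn : 0 < ‖v‖ := norm_pos_iff.2 hv0
      have h1 : Φ s ≤ Φ (‖v‖⁻¹ • v) := hmin (by simp [norm_smul, hn.ne'])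
      rw [hΦ.1.2.1 _ _ (by positivity)] at h1
      rw [le_inv_comm₀ hn hsp]
      calc Φ s ≤ ‖v‖⁻¹ * Φ v := h1
        _ ≤ ‖v‖⁻¹ * 1 := by gcongr
        _ = _ := mul_one _
  · refine Convex.inter ?_ X.1.convex
    intro x hx y hy a b ha hb hab
    have hx : Φ x ≤ 1 := hx
    have hy : Φ y ≤ 1 := hy
    have := hΦ.1.2.2 (a • x) (b • y)
    rw [hΦ.1.2.1 a x ha, hΦ.1.2.1 b y hb] at this
    change Φ _ ≤ 1
    nlinarith
  · refine ⟨0, mem_interior.2 ⟨{x : X.1 | Φ x < 1}, ?_, ?_, ?_⟩⟩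
    · intro x hx
      have hx : Φ x < 1 := hx
      exact ⟨show Φ x ≤ 1 from hx.le, x.2⟩
    · exact isOpen_lt (hΦc.comp continuous_subtype_val) continuous_const
    · change Φ ((0 : X.1) : V) < 1
      rw [Submodule.coe_zero, norm_zero' hΦ]; norm_num
  · constructor
    · rw [Submodule.disjoint_def]
      intro x hx hx'
      rw [← hP' x hx]; exact hx'
    · rw [codisjoint_iff, eq_top_iff]
      intro v _
      refine Submodule.mem_sup.2 ⟨P v, hP v, v - P v, ?_, by abel⟩
      rw [LinearMap.mem_ker, map_sub, hP' _ (hP v), sub_self]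
  · ext v
    constructor
    · intro hv
      refine ⟨P v, ⟨hv, hP v⟩, v - P v, ?_, by simp⟩
      change v - P v ∈ LinearMap.ker P
      rw [LinearMap.mem_ker, map_sub, hP' _ (hP v), sub_self]
    · rintro ⟨a, ⟨ha, haX⟩, b, hb, rfl⟩
      have hb : P b = 0 := hb
      change Φ (P (a + b)) ≤ 1
      rw [map_add, hb, add_zero, hP' a haX]; exact ha

lemma ellipsoid_transfer {Φ : V → ℝ} (hΦ : IsMinkowskiNorm Φ) (X X₀ : Gr k V) (P : V →ₗ[ℝ] V)
    (hP : ∀ v, P v ∈ X₀.1) (h : ∀ x ∈ X.1, Φ x = Φ (P x))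
    (hQ : ∃ Q : QuadraticForm ℝ X.1, ∀ x : X.1, Φ x ^ 2 = Q x) :
    ∃ Q : QuadraticForm ℝ X₀.1, ∀ x : X₀.1, Φ x ^ 2 = Q x := by
  obtain ⟨Q, hQ⟩ := hQ
  let f : X.1 →ₗ[ℝ] X₀.1 := (P.codRestrict X₀.1 hP) ∘ₗ X.1.subtype
  have hf : ∀ x : X.1, ((f x : X₀.1) : V) = P x := fun x => rfl
  have hinj : Function.Injective f := by
    rw [← LinearMap.ker_eq_bot, Submodule.eq_bot_iff]
    intro x hx
    by_contra hx0
    have h1 := hΦ.2 x (by simpa using hx0)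
    rw [h x x.2, ← hf, LinearMap.mem_ker.1 hx, Submodule.coe_zero, norm_zero' hΦ] at h1
    exact lt_irrefl _ h1
  let e := LinearEquiv.ofInjectiveOfFinrankEq f hinj (by rw [X.2, X₀.2])
  have he : ∀ x, e x = f x := fun x => rfl
  refine ⟨Q.comp e.symm.toLinearMap, fun x => ?_⟩
  obtain ⟨y, rfl⟩ := e.surjective x
  simp only [QuadraticMap.comp_apply, LinearEquiv.coe_coe, LinearEquiv.symm_apply_apply]
  rw [← hQ, he, hf, ← h y y.2]

end
end RT

/-- **Relaxed conclusion.** If for every `X` in a nonempty connected open set `𝒰` the unit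
ball `B` is locally cylindrical near `X` or `B ∩ X` is a 0-centered ellipsoid, then there
is `B'` agreeing with `B` on all `X ∈ 𝒰` which is a `k`-cylinder or the sublevel set of a
nonnegative definite quadratic form. -/
theorem relaxed_theorem_conclusion
    {V : Type*} [NormedAddCommGroup V] [NormedSpace ℝ V] [FiniteDimensional ℝ V]
    (n k : ℕ) (hn : Module.finrank ℝ V = n) (hk : 2 ≤ k) (hkn : k < n)
    (Φ : V → ℝ) (hΦ : IsMinkowskiNorm Φ) (B : Set V) (hB : B = {v | Φ v ≤ 1})
    (𝒰 : Set (Gr k V)) (h𝒰open : IsOpen 𝒰) (h𝒰conn : IsConnected 𝒰)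
    (h : ∀ X ∈ 𝒰, IsLocallyCylindricalNear k B X.1 ∨
      IsEllipsoidIn X.1 (B ∩ (X.1 : Set V))) :
    ∃ B' : Set V,
      (∀ X ∈ 𝒰, B ∩ (X.1 : Set V) = B' ∩ (X.1 : Set V)) ∧
      (IsCylinder k B' ∨
        ∃ Q : QuadraticForm ℝ V, (∀ v, 0 ≤ Q v) ∧ B' = {v | Q v ≤ 1}) := by
  subst hB
  have hΦc := RT.norm_continuous hΦ
  by_cases hE : ∀ X ∈ 𝒰, IsEllipsoidIn X.1 ({v | Φ v ≤ 1} ∩ (X.1 : Set V))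
  · have hE' : ∀ X ∈ 𝒰, ∃ Q : QuadraticForm ℝ X.1, ∀ x : X.1, Φ x ^ 2 = Q x :=
      fun X hX => (RT.ellipsoid_iff hΦ X.1).1 (hE X hX)
    obtain ⟨X₀, hX₀⟩ := h𝒰conn.nonempty
    obtain ⟨Q, hQ⟩ := RT.quad_local hk hΦ h𝒰open hE' X₀ hX₀
    have hall := RT.propagate (RT.hom2_sq hΦ) (RT.hom2_quad Q) h𝒰conn.isPreconnected X₀ hX₀ hQ (by
      intro X hX
      obtain ⟨Q', hQ'⟩ := RT.quad_local hk hΦ h𝒰open hE' X hX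
      refine ⟨_, RT.isOpen_germ (RT.hom2_sq hΦ) (RT.hom2_quad Q'), hQ', ?_⟩
      rintro ⟨X', h1, -, h2⟩
      haveI : Nontrivial X'.1 := Module.nontrivial_of_finrank_pos (R := ℝ) (by rw [X'.2]; omega)
      obtain ⟨x, hx⟩ := exists_ne (0 : X'.1)
      have hx' : (x : V) ≠ 0 := by simpa using hx
      have : Q = Q' := RT.quad_unique Q Q' x (by
        filter_upwards [h1 x x.2 hx', h2 x x.2 hx'] with v a b
        rw [← a, ← b])
      rw [this]; exact hQ')
    refine ⟨{v | Q v ≤ 1}, ?_, Or.inr ⟨Q, RT.quad_nonneg hk hΦ X₀ Q hQ, rfl⟩⟩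
    intro X hX
    ext v
    refine and_congr_left fun hv => ?_
    change Φ v ≤ 1 ↔ Q v ≤ 1
    by_cases hv0 : v = 0
    · subst hv0; simp [RT.norm_zero' hΦ]
    have h1 : Φ v ^ 2 = Q v := (hall X hX v hv hv0).self_of_nhds
    rw [← h1, sq_le_one_iff₀ (hΦ.1.1 v)]
  · push Not at hE
    obtain ⟨X₀, hX₀, hne⟩ := hE
    rw [RT.ellipsoid_iff hΦ] at hne
    have hcyl : ∀ X ∈ 𝒰, (¬ ∃ Q : QuadraticForm ℝ X.1, ∀ x : X.1, Φ x ^ 2 = Q x) →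
        ∃ P : V →ₗ[ℝ] V, (∀ v, P v ∈ X.1) ∧ (∀ x ∈ X.1, P x = x) ∧
          ∀ x ∈ X.1, x ≠ 0 → ∀ᶠ v in nhds x, Φ v = Φ (P v) := by
      intro X hX hX'
      rcases h X hX with h1 | h1
      · exact RT.cyl_local hΦ X h1
      · exact absurd ((RT.ellipsoid_iff hΦ X.1).1 h1) hX'
    obtain ⟨P, hP, hP', hPg⟩ := hcyl X₀ hX₀ hne
    have hPc : Continuous P := P.continuous_of_finiteDimensional
    have hall := RT.propagate (RT.hom2_sq hΦ) (RT.hom2_sq_comp hΦ P) h𝒰conn.isPreconnected X₀ hX₀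
      ((RT.germ_sq_iff hΦ _ P).2 hPg) (by
      intro X hX
      by_cases hag : ∀ x ∈ X.1, Φ x = Φ (P x)
      · obtain ⟨P₁, hP₁, hP₁', hP₁g⟩ := hcyl X hX (fun hQ =>
          hne (RT.ellipsoid_transfer hΦ X X₀ P hP hag hQ))
        refine ⟨_, RT.isOpen_germ (RT.hom2_sq hΦ) (RT.hom2_sq_comp hΦ P₁),
          (RT.germ_sq_iff hΦ _ P₁).2 hP₁g, ?_⟩
        rintro ⟨X', h1, -, h2⟩
        have h1 := (RT.germ_sq_iff hΦ _ P₁).1 h1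
        have h2 := (RT.germ_sq_iff hΦ _ P).1 h2
        have hker := RT.ker_le hΦ X' X₀ P P₁ hP h2 h1
        have heq : ∀ v, Φ (P₁ v) = Φ (P v) := by
          intro v
          rw [hag _ (hP₁ v)]
          have : v - P₁ v ∈ LinearMap.ker P := hker (by
            rw [LinearMap.mem_ker, map_sub, hP₁' _ (hP₁ v), sub_self])
          rw [LinearMap.mem_ker, map_sub, sub_eq_zero] at this
          rw [this]
        rw [RT.germ_sq_iff hΦ]
        simpa only [heq] using hP₁g
      · push Not at hag
        obtain ⟨x, hx, hxne⟩ := hag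
        refine ⟨_, RT.isOpen_hit (W := {v | Φ v ≠ Φ (P v)})
          (isOpen_ne_fun hΦc (hΦc.comp hPc)), ⟨x, hx, hxne⟩, ?_⟩
        rintro ⟨X', ⟨y, hy, hyne⟩, -, h2⟩
        have h2 := (RT.germ_sq_iff hΦ _ P).1 h2
        exfalso
        by_cases hy0 : y = 0
        · subst hy0; exact hyne (by rw [map_zero])
        · exact hyne (h2 y hy hy0).self_of_nhds)
    refine ⟨{v | Φ (P v) ≤ 1}, ?_, Or.inl (RT.cyl_final hΦ X₀ P hP hP')⟩
    intro X hX
    ext v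
    refine and_congr_left fun hv => ?_
    change Φ v ≤ 1 ↔ Φ (P v) ≤ 1
    by_cases hv0 : v = 0
    · subst hv0; simp
    rw [((RT.germ_sq_iff hΦ _ P).1 (hall X hX) v hv hv0).self_of_nhds]
end

section
/- Let V be a 3-dimensional real vector space, B ⊂ V a convex body with 0 in its interior, and 𝒰 ⊂ Gr₂ V a nonempty connected open set of 2-dimensional linear subspaces such that for every X ∈ 𝒰 there exists a line L ∈ Gr₁ V with B ⊂ (B ∩ X) + L. Then for every X ∈ 𝒰 the line L ∈ Gr₁ V satisfying B ⊂ (B ∩ X) + L is unique. -/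
open Module Set Pointwise

open Filter Topology in
theorem smooth_point {E : Type*} [NormedAddCommGroup E] [NormedSpace ℝ E] [FiniteDimensional ℝ E]
    (N : E → ℝ) (C : NNReal) (hL : LipschitzWith C N) (hadd : ∀ x y, N (x + y) ≤ N x + N y)
    (hsmul : ∀ (t : ℝ) x, 0 ≤ t → N (t • x) = t * N x) (a : E) (ha : 0 < N a) :
    ∃ (x : E) (f : E →ₗ[ℝ] ℝ), 0 < N x ∧ f x = N x ∧ (∀ v, f v ≤ N v) ∧ f a ≠ 0 ∧
      ∀ g : E →ₗ[ℝ] ℝ, (∀ v, g v ≤ N v) → g x = N x → g = f := by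
  have hN0 : N 0 = 0 := by simpa using hsmul 0 0 le_rfl
  have hcont : Continuous N := hL.continuous
  have hd : Dense {x | DifferentiableAt ℝ N x} := by
    letI : MeasurableSpace E := borel E
    haveI : BorelSpace E := ⟨rfl⟩
    let w := Module.Basis.ofVectorSpace ℝ E
    exact MeasureTheory.Measure.dense_of_ae (hL.ae_differentiableAt (μ := w.addHaar))
  have ho : IsOpen {x | 0 < N x ∧ N (x - a) < N x} :=
    (isOpen_lt continuous_const hcont).inter
      (isOpen_lt (hcont.comp (continuous_id.sub continuous_const)) hcont)
  obtain ⟨x, ⟨hx1, hx2⟩, hx⟩ := hd.inter_open_nonempty _ ho ⟨a, ha, by simpa [hN0] using ha⟩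
  have hx : DifferentiableAt ℝ N x := hx
  have hs : ∀ v, Tendsto (fun t : ℝ => t⁻¹ • (N (x + t • v) - N x)) (𝓝[>] 0)
      (𝓝 (fderiv ℝ N x v)) := by
    intro v
    have h1 : HasDerivAt (fun t : ℝ => x + t • v) v 0 := by
      simpa using ((hasDerivAt_id (0:ℝ)).smul_const v).const_add x
    have h2 : HasFDerivAt N (fderiv ℝ N x) (x + (0:ℝ) • v) := by simpa using hx.hasFDerivAt
    have h3 := (h2.comp_hasDerivAt (0:ℝ) h1).tendsto_slope_zero_right
    simpa using h3
  have hle : ∀ v, fderiv ℝ N x v ≤ N v := by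
    intro v
    refine le_of_tendsto (hs v) ?_
    filter_upwards [self_mem_nhdsWithin] with t ht
    have ht : (0:ℝ) < t := ht
    have := hadd x (t • v)
    rw [hsmul t v ht.le] at this
    rw [smul_eq_mul, inv_mul_le_iff₀ ht]
    linarith
  have heq : fderiv ℝ N x x = N x := by
    refine tendsto_nhds_unique (hs x) (tendsto_const_nhds.congr' ?_)
    filter_upwards [self_mem_nhdsWithin] with t ht
    have ht : (0:ℝ) < t := ht
    have : x + t • x = (1 + t) • x := by module
    rw [this, hsmul _ _ (by linarith), smul_eq_mul]
    field_simp
    ring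
  refine ⟨x, (fderiv ℝ N x : E →ₗ[ℝ] ℝ), hx1, heq, hle, ?_, ?_⟩
  · intro h
    have h' : fderiv ℝ N x a = 0 := h
    have := hle (x - a)
    rw [map_sub, heq, h'] at this
    linarith
  · intro g hg hgx
    have hm : IsLocalMin (fun v => N v - LinearMap.toContinuousLinearMap g v) x := by
      refine Filter.Eventually.of_forall fun v => ?_
      have := hg v
      simp [hgx, this]
    have h0 := hm.hasFDerivAt_eq_zero
      (hx.hasFDerivAt.sub (LinearMap.toContinuousLinearMap g).hasFDerivAt)
    ext v
    have := congrArg (fun k : E →L[ℝ] ℝ => k v) h0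
    simp at this
    simp
    linarith

theorem exists_proj
    {V : Type*} [NormedAddCommGroup V] [NormedSpace ℝ V] [FiniteDimensional ℝ V]
    (hV : Module.finrank ℝ V = 3) (B : Set V) (hB : IsConvexBody B) (h0 : 0 ∈ interior B)
    (X L : Submodule ℝ V) (hX : Module.finrank ℝ X = 2) (hL : Module.finrank ℝ L = 1)
    (h : B ⊆ (B ∩ (X : Set V)) + (L : Set V)) :
    ∃ P : V →ₗ[ℝ] V, (∀ v, P v ∈ X) ∧ (∀ v ∈ X, P v = v) ∧ LinearMap.ker P = L ∧
      ∀ v, gauge B (P v) ≤ gauge B v := by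
  have hnhds : B ∈ nhds (0:V) := mem_interior_iff_mem_nhds.1 h0
  have habs : Absorbent ℝ B := absorbent_nhds_zero hnhds
  have hLX : ¬ L ≤ X := by
    intro hle
    have hBX : B ⊆ X := by
      intro b hb
      obtain ⟨k, hk, l, hl, rfl⟩ := h hb
      exact X.add_mem hk.2 (hle hl)
    have : X = ⊤ := by
      apply Submodule.eq_top_of_nonempty_interior'
      exact ⟨0, interior_mono hBX h0⟩
    rw [this, finrank_top, hV] at hX
    omega
  have hdis : Disjoint L X := (IsAtom.not_le_iff_disjoint ((Submodule.isAtom_iff_finrank_eq_one).2 hL)).1 hLX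
  have hc : IsCompl X L := (Submodule.isCompl_iff_disjoint X L (by omega)).2 hdis.symm
  refine ⟨X.projection L hc, Submodule.projection_apply_mem hc,
    fun v hv => Submodule.projection_apply_of_mem_left hc hv, Submodule.ker_projection hc, ?_⟩
  intro v
  refine le_of_forall_gt_imp_ge_of_dense fun r hr => ?_
  obtain ⟨b, hb0, hbr, w, hw, rfl⟩ := exists_lt_of_gauge_lt habs hr
  refine le_trans (gauge_le_of_mem hb0.le ?_) hbr.le
  obtain ⟨k, hk, l, hl, rfl⟩ := h hw
  refine ⟨k, hk.1, ?_⟩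
  simp only [map_smul, map_add]
  rw [Submodule.projection_apply_of_mem_left hc hk.2, Submodule.projection_apply_of_mem_right hc hl,
    add_zero]

open Filter Topology in
theorem no_two
    {V : Type*} [NormedAddCommGroup V] [NormedSpace ℝ V] [FiniteDimensional ℝ V]
    (hV : Module.finrank ℝ V = 3)
    (B : Set V) (hB : IsConvexBody B) (h0 : 0 ∈ interior B)
    (𝒰 : Set (Gr 2 V)) (h𝒰open : IsOpen 𝒰)
    (hex : ∀ X ∈ 𝒰, ∃ L : Submodule ℝ V, Module.finrank ℝ L = 1 ∧
      B ⊆ (B ∩ (X.1 : Set V)) + (L : Set V)) (X : Gr 2 V) (hX : X ∈ 𝒰)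
    (P1 P2 : V →ₗ[ℝ] V) (h1 : ∀ v, P1 v ∈ X.1) (h1' : ∀ v ∈ X.1, P1 v = v)
    (h1n : ∀ v, gauge B (P1 v) ≤ gauge B v)
    (h2 : ∀ v, P2 v ∈ X.1) (h2' : ∀ v ∈ X.1, P2 v = v)
    (h2n : ∀ v, gauge B (P2 v) ≤ gauge B v) : P1 = P2 := by
  by_contra hne
  obtain ⟨v, hv⟩ : ∃ v, P1 v ≠ P2 v := by
    by_contra hh
    push Not at hh
    exact hne (LinearMap.ext hh)
  have hnhds : B ∈ nhds (0:V) := mem_interior_iff_mem_nhds.1 h0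
  have habs : Absorbent ℝ B := absorbent_nhds_zero hnhds
  obtain ⟨R, hR0, hR⟩ : ∃ R : ℝ, 0 < R ∧ B ⊆ Metric.closedBall 0 R := by
    obtain ⟨R, hR⟩ := hB.1.isBounded.subset_closedBall (0:V)
    exact ⟨max R 1, by positivity, hR.trans (Metric.closedBall_subset_closedBall (le_max_left _ _))⟩
  have hlow : ∀ v, ‖v‖ / R ≤ gauge B v := fun v => le_gauge_of_subset_closedBall habs hR0.le hR
  have hpos : ∀ v, v ≠ 0 → 0 < gauge B v := fun v hv =>
    lt_of_lt_of_le (by have := norm_pos_iff.2 hv; positivity) (hlow v)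
  set e := v - P1 v with he
  have he1 : P1 e = 0 := by rw [he, map_sub, h1' _ (h1 v), sub_self]
  have he2 : P2 e = P2 v - P1 v := by rw [he, map_sub, h2' _ (h1 v)]
  have heX : e ∉ X.1 := by
    intro hmem
    have : e = 0 := by rw [← h1' e hmem, he1]
    apply hv
    rw [this, map_zero] at he2
    exact (sub_eq_zero.1 he2.symm).symm
  obtain ⟨C, hC⟩ := hB.2.1.lipschitz_gauge hnhds
  let a : X.1 := ⟨P2 e, h2 e⟩
  have ha : P2 e ≠ 0 := by rw [he2]; exact sub_ne_zero.2 (Ne.symm hv)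
  obtain ⟨x, f, hx, hfx, hf, hfa, huniq⟩ := smooth_point (fun y : X.1 => gauge B (y : V)) C
    (by
      have := hC.comp (LipschitzWith.subtype_val (X.1 : Set V))
      rw [mul_one] at this
      exact this)
    (fun y z => by simpa using gauge_add_le hB.2.1 habs (y:V) (z:V))
    (fun t y ht => by simpa using gauge_smul_of_nonneg (s := B) ht (y:V)) a (hpos _ ha)
  -- direction `d`
  obtain ⟨d, hd0, hfd⟩ : ∃ d : X.1, d ≠ 0 ∧ f d = 0 := by
    have hk : LinearMap.ker f ≠ ⊥ := by
      apply LinearMap.ker_ne_bot_of_finrank_lt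
      rw [X.2]; simp
    obtain ⟨d, hd, hd0⟩ := Submodule.exists_mem_ne_zero_of_ne_bot hk
    exact ⟨d, hd0, hd⟩
  have hindep : ∀ ε : ℝ, LinearIndependent ℝ ![(x:V), (d:V) + ε • e] := by
    intro ε
    rw [LinearIndependent.pair_iff]
    intro s t hst
    have hP := congrArg P1 hst
    simp only [map_add, map_smul, he1, smul_zero, add_zero, map_zero, h1' _ x.2, h1' _ d.2] at hP
    have hP' : s • x + t • d = 0 := Subtype.ext (by simpa using hP)
    have hff := congrArg f hP'
    simp only [map_add, map_smul, hfd, smul_eq_mul, mul_zero, add_zero, map_zero, hfx] at hff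
    have hs : s = 0 := by
      rcases mul_eq_zero.1 hff with h | h
      · exact h
      · exact absurd h hx.ne'
    refine ⟨hs, ?_⟩
    rw [hs, zero_smul, zero_add] at hP'
    exact (smul_eq_zero.1 hP').resolve_right hd0
  let F : ℝ → {v : Fin 2 → V // LinearIndependent ℝ v} := fun ε => ⟨_, hindep ε⟩
  have hF : Continuous F := by
    refine Continuous.subtype_mk ?_ _
    refine continuous_pi fun i => ?_
    fin_cases i
    · exact continuous_const
    · show Continuous fun ε : ℝ => (d:V) + ε • e
      fun_prop
  let S : {v : Fin 2 → V // LinearIndependent ℝ v} → Gr 2 V := fun v =>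
    ⟨Submodule.span ℝ (Set.range v.1), by rw [finrank_span_eq_card v.2, Fintype.card_fin]⟩
  have hS : Continuous S := continuous_coinduced_rng
  have hS0 : S (F 0) = X := by
    apply Subtype.ext
    apply Submodule.eq_of_le_of_finrank_eq
    · show Submodule.span ℝ (Set.range ![(x:V), (d:V) + (0:ℝ) • e]) ≤ X.1
      rw [Submodule.span_le]
      rintro _ ⟨i, rfl⟩
      fin_cases i
      · exact x.2
      · simp
    · rw [(S (F 0)).2, X.2]
  have hev : ∀ᶠ ε in 𝓝 (0:ℝ), S (F ε) ∈ 𝒰 :=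
    (hS.comp hF).continuousAt.eventually_mem (h𝒰open.mem_nhds (by simpa [hS0] using hX))
  -- key estimate
  have key : ∀ ε : ℝ, 0 < ε → S (F ε) ∈ 𝒰 → ‖(d:V)‖ ≤ ε * (R * gauge B e + ‖e‖) := by
    intro ε hε hmem
    obtain ⟨L, hL, hBL⟩ := hex _ hmem
    obtain ⟨P, hP, hP', -, hPn⟩ := exists_proj hV B hB h0 _ L (S (F ε)).2 hL hBL
    have hxm : (x:V) ∈ (S (F ε)).1 := Submodule.subset_span ⟨0, rfl⟩
    have hdm : (d:V) + ε • e ∈ (S (F ε)).1 := Submodule.subset_span ⟨1, rfl⟩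
    have hg : ∀ Q : V →ₗ[ℝ] V, ∀ hQ : ∀ v, Q v ∈ X.1, (∀ v ∈ X.1, Q v = v) →
        (∀ v, gauge B (Q v) ≤ gauge B v) → f ⟨Q (P d), hQ _⟩ = 0 := by
      intro Q hQ hQ' hQn
      have := huniq (f ∘ₗ (Q.codRestrict X.1 hQ) ∘ₗ P ∘ₗ X.1.subtype)
        (fun y => (hf _).trans ((hQn _).trans (hPn _)))
        (by
          rw [← hfx]
          simp only [LinearMap.comp_apply]
          congr 1
          apply Subtype.ext
          simp [hP' _ hxm, hQ' _ x.2])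
      rw [← hfd]
      conv_rhs => rw [← this]
      rfl
    have g1 := hg P1 h1 h1' h1n
    have g2 := hg P2 h2 h2' h2n
    have hPd : P d ∈ Submodule.span ℝ {(x:V), (d:V) + ε • e} := by
      have := hP (d:V)
      have hr : Set.range (F ε).1 = {(x:V), (d:V) + ε • e} := by
        show Set.range ![(x:V), (d:V) + ε • e] = _
        simp [Matrix.range_cons, Matrix.range_empty, Set.pair_comm]
      change P d ∈ Submodule.span ℝ (Set.range (F ε).1) at this
      rwa [hr] at this
    obtain ⟨s, u, hsu⟩ := Submodule.mem_span_pair.1 hPd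
    have e1 : (⟨P1 (P d), h1 _⟩ : X.1) = s • x + u • d := by
      apply Subtype.ext
      simp [← hsu, h1' _ x.2, h1' _ d.2, he1]
    have e2 : (⟨P2 (P d), h2 _⟩ : X.1) = s • x + u • d + (u * ε) • a := by
      apply Subtype.ext
      simp [← hsu, h2' _ x.2, h2' _ d.2, a, mul_smul, add_assoc]
    rw [e1] at g1
    rw [e2] at g2
    simp only [map_add, map_smul, hfd, hfx, smul_eq_mul, mul_zero, add_zero] at g1 g2
    have hs : s = 0 := (mul_eq_zero.1 g1).resolve_right hx.ne'
    have hu : u = 0 := by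
      rw [hs, zero_mul, zero_add] at g2
      exact (mul_eq_zero.1 ((mul_eq_zero.1 g2).resolve_right hfa)).resolve_right hε.ne'
    have hPd0 : P d = 0 := by rw [← hsu, hs, hu]; simp
    have h3 : ε • P e = (d:V) + ε • e := by
      have := hP' _ hdm
      rwa [map_add, hPd0, zero_add, map_smul] at this
    have h4 : ‖P e‖ ≤ R * gauge B e := by
      have := (hlow (P e)).trans (hPn e)
      rwa [div_le_iff₀ hR0, mul_comm] at this
    have h5 : (d:V) = ε • (P e - e) := by rw [smul_sub, h3]; simp
    rw [h5, norm_smul, Real.norm_of_nonneg hε.le]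
    have := norm_sub_le (P e) e
    gcongr
    linarith
  have hlim : Tendsto (fun ε : ℝ => ε * (R * gauge B e + ‖e‖)) (𝓝[>] 0) (𝓝 0) := by
    have : Continuous (fun ε : ℝ => ε * (R * gauge B e + ‖e‖)) := by fun_prop
    simpa using (this.tendsto 0).mono_left nhdsWithin_le_nhds
  have hfin : ‖(d:V)‖ ≤ 0 := by
    refine ge_of_tendsto hlim ?_
    filter_upwards [self_mem_nhdsWithin, nhdsWithin_le_nhds hev] with ε hε hm
    exact key ε hε hm
  exact hd0 (Subtype.ext (by simpa using hfin))

/-- **Uniqueness of the generatrix line in dimension 3.** -/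
theorem unique_line
    {V : Type*} [NormedAddCommGroup V] [NormedSpace ℝ V] [FiniteDimensional ℝ V]
    (hV : Module.finrank ℝ V = 3)
    (B : Set V) (hB : IsConvexBody B) (h0 : 0 ∈ interior B)
    (𝒰 : Set (Gr 2 V)) (h𝒰open : IsOpen 𝒰) (h𝒰conn : IsConnected 𝒰)
    (hex : ∀ X ∈ 𝒰, ∃ L : Submodule ℝ V, Module.finrank ℝ L = 1 ∧
      B ⊆ (B ∩ (X.1 : Set V)) + (L : Set V)) :
    ∀ X ∈ 𝒰, ∃! L : Submodule ℝ V, Module.finrank ℝ L = 1 ∧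
      B ⊆ (B ∩ (X.1 : Set V)) + (L : Set V) := by
  intro X hX
  obtain ⟨L, hL, hBL⟩ := hex X hX
  refine ⟨L, ⟨hL, hBL⟩, ?_⟩
  rintro L' ⟨hL', hBL'⟩
  obtain ⟨P, hP, hP', hk, hn⟩ := exists_proj hV B hB h0 X.1 L X.2 hL hBL
  obtain ⟨Q, hQ, hQ', hk', hn'⟩ := exists_proj hV B hB h0 X.1 L' X.2 hL' hBL'
  rw [← hk, ← hk', no_two hV B hB h0 𝒰 h𝒰open hex X hX P Q hP hP' hn hQ hQ' hn']
end

section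
/- Let V be a 3-dimensional real vector space, B ⊂ V a convex body with 0 in its interior, and 𝒰 ⊂ Gr₂ V a nonempty connected open set such that for every X ∈ 𝒰 there exists a (necessarily unique) line φ(X) ∈ Gr₁ V with B ⊂ (B ∩ X) + φ(X). If the map φ : 𝒰 → Gr₁ V is not injective, then there exists a 2-cylinder C ⊂ V such that B ∩ X = C ∩ X for all X ∈ 𝒰. -/
open Module Set Pointwise

structure DCNm {V : Type*} [NormedAddCommGroup V] [NormedSpace ℝ V] (Φ : V → ℝ) : Prop where
  add : ∀ v w, Φ (v + w) ≤ Φ v + Φ w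
  smul : ∀ (c : ℝ) v, 0 ≤ c → Φ (c • v) = c * Φ v
  pos : ∀ v, v ≠ 0 → 0 < Φ v
  cont : Continuous Φ
  lower : ∃ m : ℝ, 0 < m ∧ ∀ v, m * ‖v‖ ≤ Φ v

def DCD {V : Type*} [NormedAddCommGroup V] [NormedSpace ℝ V] (Φ : V → ℝ)
    (ξ : V →L[ℝ] ℝ) (e : V) : Prop :=
  ∀ x, ξ x = 0 → ∀ t : ℝ, Φ x ≤ Φ (x + t • e)

section DC
variable {V : Type*} [NormedAddCommGroup V] [NormedSpace ℝ V]

lemma DCNm.zero {Φ : V → ℝ} (h : DCNm Φ) : Φ 0 = 0 := by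
  have := h.smul 0 0 le_rfl
  simpa using this

lemma DCNm.nonneg {Φ : V → ℝ} (h : DCNm Φ) (v : V) : 0 ≤ Φ v := by
  by_cases hv : v = 0
  · rw [hv, h.zero]
  · exact (h.pos v hv).le

lemma DCD.ne {Φ : V → ℝ} (h : DCNm Φ) {ξ : V →L[ℝ] ℝ} {e : V} (he : e ≠ 0)
    (hd : DCD Φ ξ e) : ξ e ≠ 0 := by
  intro h1
  have := hd e h1 (-1)
  have h2 := h.pos e he
  simp [h.zero] at this
  linarith

/-- projection form -/
lemma DCD.proj {Φ : V → ℝ} {ξ : V →L[ℝ] ℝ} {e : V}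
    (hd : DCD Φ ξ e) (h1 : ξ e ≠ 0) (x : V) : Φ (x - (ξ x / ξ e) • e) ≤ Φ x := by
  have := hd (x - (ξ x / ξ e) • e) (by simp; field_simp; ring) (ξ x / ξ e)
  simpa using this

lemma DCD.proj1 {Φ : V → ℝ} {ξ : V →L[ℝ] ℝ} {e : V}
    (hd : DCD Φ ξ e) (h1 : ξ e = 1) (x : V) : Φ (x - ξ x • e) ≤ Φ x := by
  have := hd.proj (by simp [h1]) x
  simpa [h1] using this

lemma DCD.of_proj1 {Φ : V → ℝ} {ξ : V →L[ℝ] ℝ} {e : V}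
    (h1 : ξ e = 1) (h : ∀ x, Φ (x - ξ x • e) ≤ Φ x) : DCD Φ ξ e := by
  intro x hx t
  have := h (x + t • e)
  simpa [hx, h1] using this

lemma DCNm.conv {Φ : V → ℝ} (h : DCNm Φ) {a b : ℝ} (ha : 0 ≤ a) (hb : 0 ≤ b) (x y : V) :
    Φ (a • x + b • y) ≤ a * Φ x + b * Φ y := by
  have := h.add (a • x) (b • y)
  rwa [h.smul _ _ ha, h.smul _ _ hb] at this

lemma DCD.eq_proj {Φ : V → ℝ} {f g : V →L[ℝ] ℝ} {e : V}
    (hf : DCD Φ f e) (hg : DCD Φ g e) (h1 : f e = 1) (h2 : g e = 1) (x : V) :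
    Φ (x - f x • e) = Φ (x - g x • e) := by
  apply le_antisymm
  · have := hf.proj1 h1 (x - g x • e)
    have e0 : x - g x • e - f (x - g x • e) • e = x - f x • e := by
      simp only [map_sub, map_smul, h1, smul_eq_mul]; module
    rwa [e0] at this
  · have := hg.proj1 h2 (x - f x • e)
    have e0 : x - f x • e - g (x - f x • e) • e = x - g x • e := by
      simp only [map_sub, map_smul, h2, smul_eq_mul]; module
    rwa [e0] at this

/-- flat points -/
lemma DC_flat_eq {Φ : V → ℝ} (h : DCNm Φ) {f g : V →L[ℝ] ℝ} {e : V}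
    (hf : DCD Φ f e) (hg : DCD Φ g e) (h1 : f e = 1) (h2 : g e = 1) (x : V)
    (hx : f x < 0) (hx' : 0 < g x) :
    Φ (x - f x • e) = Φ x ∧ Φ (x - g x • e) = Φ x := by
  have e1 := hf.eq_proj hg h1 h2 x
  have e2 := hf.proj1 h1 x
  have hp : 0 < g x - f x := by linarith
  have e3 := h.conv (a := g x / (g x - f x)) (b := -f x / (g x - f x))
    (by positivity) (div_nonneg (by linarith) hp.le) (x - f x • e) (x - g x • e)
  have e4 : (g x / (g x - f x)) • (x - f x • e) + (-f x / (g x - f x)) • (x - g x • e) = x := by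
    have : x = ((g x / (g x - f x)) + (-f x / (g x - f x))) • x := by
      rw [← add_div, ← sub_eq_add_neg, div_self hp.ne', one_smul]
    conv_rhs => rw [this]
    match_scalars <;> field_simp <;> ring
  rw [e4, ← e1, ← add_mul, ← add_div, ← sub_eq_add_neg, div_self hp.ne', one_mul] at e3
  constructor
  · linarith
  · linarith

lemma DC_flat_plane {Φ : V → ℝ} (h : DCNm Φ) {e e' x : V} {a b : ℝ} (ha : 0 < a) (hb : 0 < b)
    (h1 : Φ (x + a • e) ≤ Φ x) (h2 : Φ (x - b • e) ≤ Φ x) (h3 : ∀ t : ℝ, Φ x ≤ Φ (x + t • e'))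
    (s t : ℝ) : Φ x ≤ Φ (x + s • e + t • e') := by
  have key : ∀ (b s : ℝ) (e : V), 0 < b → 0 ≤ s → Φ (x - b • e) ≤ Φ x →
      Φ x ≤ Φ (x + s • e + t • e') := by
    intro b s e hb hs h2
    have hp : 0 < s + b := by linarith
    have e3 := h.conv (a := b / (s + b)) (b := s / (s + b)) (by positivity) (by positivity)
      (x + s • e + t • e') (x - b • e)
    have e4 : (b / (s + b)) • (x + s • e + t • e') + (s / (s + b)) • (x - b • e)
        = x + (b / (s + b) * t) • e' := by
      have : x = ((b / (s + b)) + (s / (s + b))) • x := by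
        rw [← add_div, add_comm b s, div_self hp.ne', one_smul]
      conv_rhs => rw [this]
      match_scalars <;> field_simp <;> ring
    rw [e4] at e3
    have e5 := h3 (b / (s + b) * t)
    have e6 : s / (s + b) * Φ (x - b • e) ≤ s / (s + b) * Φ x := by gcongr
    have e7 : b / (s + b) * Φ x ≤ b / (s + b) * Φ (x + s • e + t • e') := by
      have : Φ x = b / (s + b) * Φ x + s / (s + b) * Φ x := by field_simp; ring
      linarith
    exact le_of_mul_le_mul_left e7 (by positivity)
  rcases le_total 0 s with hs | hs
  · exact key b s e hb hs h2
  · have := key a (-s) (-e) ha (by linarith) (by simpa using h1)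
    simpa using this

variable [FiniteDimensional ℝ V]

lemma DC_basis3 (hV : Module.finrank ℝ V = 3) (a b c : V)
    (h : ∀ r s t : ℝ, r • a + s • b + t • c = 0 → r = 0 ∧ s = 0 ∧ t = 0) :
    ∃ α β γ : V →L[ℝ] ℝ, (α a = 1 ∧ α b = 0 ∧ α c = 0) ∧ (β a = 0 ∧ β b = 1 ∧ β c = 0) ∧
      (γ a = 0 ∧ γ b = 0 ∧ γ c = 1) ∧ ∀ v, v = α v • a + β v • b + γ v • c := by
  have hli : LinearIndependent ℝ ![a, b, c] := by
    rw [Fintype.linearIndependent_iff]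
    intro g hg
    have := h (g 0) (g 1) (g 2) (by simpa [Fin.sum_univ_three] using hg)
    intro i
    fin_cases i
    · exact this.1
    · exact this.2.1
    · exact this.2.2
  let B := basisOfLinearIndependentOfCardEqFinrank hli (by simp [hV])
  have h0 : B 0 = a := by simp [B]
  have h1 : B 1 = b := by simp [B]
  have h2 : B 2 = c := by simp [B]
  refine ⟨LinearMap.toContinuousLinearMap (B.coord 0), LinearMap.toContinuousLinearMap (B.coord 1),
    LinearMap.toContinuousLinearMap (B.coord 2), ?_, ?_, ?_, ?_⟩
  · rw [← h0, ← h1, ← h2]; simp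
  · rw [← h0, ← h1, ← h2]; simp
  · rw [← h0, ← h1, ← h2]; simp
  · intro v
    have := B.sum_repr v
    rw [Fin.sum_univ_three, h0, h1, h2] at this
    simpa using this.symm

lemma DC_pair (hV : Module.finrank ℝ V = 3) (e e' : V)
    (h : ∀ s t : ℝ, s • e + t • e' = 0 → s = 0 ∧ t = 0) :
    ∃ μ : V →L[ℝ] ℝ, μ e = 0 ∧ μ e' = 0 ∧ ∀ v, μ v = 0 → ∃ s t : ℝ, v = s • e + t • e' := by
  have : Submodule.span ℝ {e, e'} ≠ ⊤ := by
    intro htop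
    classical
    have h1 := finrank_span_finset_le_card (R := ℝ) ({e, e'} : Finset V)
    rw [Finset.coe_pair, Set.finrank, htop, finrank_top, hV] at h1
    have h2 : ({e, e'} : Finset V).card ≤ 2 := Finset.card_le_two
    omega
  obtain ⟨w, hw⟩ : ∃ w, w ∉ Submodule.span ℝ {e, e'} := by
    by_contra hc
    push Not at hc
    exact this (by ext v; simp [hc v])
  obtain ⟨α, β, γ, -, -, hγ, hv⟩ := DC_basis3 hV e e' w (by
    intro r s t hh
    have ht : t = 0 := by
      by_contra ht
      apply hw
      rw [Submodule.mem_span_pair]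
      refine ⟨-r / t, -s / t, ?_⟩
      have : w = t⁻¹ • (t • w) := by rw [smul_smul, inv_mul_cancel₀ ht, one_smul]
      have h3 : t • w = -(r • e + s • e') := by
        rw [eq_neg_iff_add_eq_zero, add_comm]; exact hh
      rw [this, h3]
      match_scalars <;> field_simp
    subst ht
    have := h r s (by simpa using hh)
    exact ⟨this.1, this.2, rfl⟩)
  refine ⟨γ, hγ.1, hγ.2.1, fun v h0 => ⟨α v, β v, ?_⟩⟩
  have := hv v
  rw [h0] at this
  simpa using this

lemma DC_ker2 (hV : Module.finrank ℝ V = 3) (f g : V →L[ℝ] ℝ) :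
    ∃ p : V, p ≠ 0 ∧ f p = 0 ∧ g p = 0 := by
  have h := LinearMap.ker_ne_bot_of_finrank_lt (f := (f : V →ₗ[ℝ] ℝ).prod (g : V →ₗ[ℝ] ℝ))
    (by simp [hV])
  obtain ⟨p, hp, hp0⟩ := Submodule.exists_mem_ne_zero_of_ne_bot h
  refine ⟨p, hp0, ?_⟩
  simpa using hp

/-- The flatness lemma -/
lemma DC_lemF (hV : Module.finrank ℝ V = 3) {Φ : V → ℝ} (h : DCNm Φ) {f g ξ : V →L[ℝ] ℝ} {e e' : V}
    (hf : DCD Φ f e) (hg : DCD Φ g e) (h1 : f e = 1) (h2 : g e = 1)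
    (hξ : DCD Φ ξ e') (hne' : e' ≠ 0) (hnot : ¬ DCD Φ ξ e) :
    ∃ l : V →L[ℝ] ℝ, l e = 0 ∧ (∀ v, l v ≤ Φ v) ∧
      ∀ x, ξ x = 0 → f x < 0 → 0 < g x → Φ x = l x := by
  have he : e ≠ 0 := by rintro rfl; simp at h1
  obtain ⟨μ, hμ, -, hker⟩ := DC_pair hV e e' (by
    intro s t hst
    have ht : t = 0 := by
      by_contra ht
      have e1 : e' = (-s / t) • e := by
        have : e' = t⁻¹ • (t • e') := by rw [smul_smul, inv_mul_cancel₀ ht, one_smul]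
        have h3 : t • e' = -(s • e) := by
          rw [eq_neg_iff_add_eq_zero, add_comm]; exact hst
        rw [this, h3]
        match_scalars; field_simp
      have hc : (-s / t) ≠ 0 := by
        intro hc
        rw [hc, zero_smul] at e1
        exact hne' e1
      apply hnot
      intro x hx r
      have := hξ x hx (r / (-s / t))
      rw [e1, smul_smul, div_mul_cancel₀ _ hc] at this
      exact this
    subst ht
    simp [he] at hst
    exact ⟨hst, rfl⟩)
  have key : ∀ x, ξ x = 0 → f x < 0 → 0 < g x → ∀ v, μ v = μ x → Φ x ≤ Φ v := by
    intro x hx hfx hgx v hv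
    obtain ⟨s, t, hst⟩ := hker (v - x) (by simp [hv])
    obtain ⟨q1, q2⟩ := DC_flat_eq h hf hg h1 h2 x hfx hgx
    have := DC_flat_plane h (e := e) (e' := e') (x := x) (a := - f x) (b := g x) (by linarith) hgx
      (by rw [neg_smul, ← sub_eq_add_neg]; exact q1.le) q2.le (hξ x hx) s t
    rw [add_assoc, ← hst] at this
    simpa using this
  have hx0 : ∀ x, g x > 0 → x ≠ 0 := by rintro x hx rfl; simp at hx
  have keyne : ∀ x, ξ x = 0 → f x < 0 → 0 < g x → μ x ≠ 0 := by
    intro x hx hfx hgx h0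
    have := key x hx hfx hgx 0 (by simp [h0])
    rw [h.zero] at this
    have := h.pos x (hx0 x hgx)
    linarith
  by_cases hemp : ∃ x, ξ x = 0 ∧ f x < 0 ∧ 0 < g x
  swap
  · refine ⟨0, by simp, fun v => by simpa using h.nonneg v, ?_⟩
    intro x a b c
    exact absurd ⟨x, a, b, c⟩ hemp
  obtain ⟨x, hx, hfx, hgx⟩ := hemp
  have hμx := keyne x hx hfx hgx
  have hpx := h.pos x (hx0 x hgx)
  have pos_of : ∀ y, ξ y = 0 → f y < 0 → 0 < g y → 0 < μ y / μ x := by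
    intro y hy hfy hgy
    by_contra hc
    push Not at hc
    have hc' : 0 < 1 - μ y / μ x := by linarith
    -- z = y - c x
    have hz : μ (y + (-(μ y / μ x)) • x) = 0 := by
      simp; field_simp; ring
    have hn : 0 ≤ -(μ y / μ x) := by linarith
    refine keyne _ (by simp [hx, hy]) ?_ ?_ hz
    · simp only [map_add, map_smul, smul_eq_mul]
      nlinarith
    · simp only [map_add, map_smul, smul_eq_mul]
      have := mul_nonneg hn hgx.le
      linarith
  refine ⟨(Φ x / μ x) • μ, by simp [hμ], ?_, ?_⟩
  · intro v
    simp only [smul_apply, smul_eq_mul]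
    by_cases hs : 0 < μ v / μ x
    · have := key x hx hfx hgx ((μ v / μ x)⁻¹ • v) (by
        have : μ v ≠ 0 := by rintro h0; simp [h0] at hs
        simp; field_simp)
      rw [h.smul _ _ (inv_nonneg.2 hs.le)] at this
      have h3 := mul_le_mul_of_nonneg_left this hs.le
      rw [← mul_assoc, mul_inv_cancel₀ hs.ne', one_mul] at h3
      calc _ = μ v / μ x * Φ x := by ring
        _ ≤ _ := h3
    · push Not at hs
      have := h.nonneg v
      have h4 : Φ x / μ x * μ v = μ v / μ x * Φ x := by ring
      rw [h4]
      nlinarith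
  · intro y hy hfy hgy
    simp only [smul_apply, smul_eq_mul]
    have hs := pos_of y hy hfy hgy
    have hμy := keyne y hy hfy hgy
    have a1 := key y hy hfy hgy ((μ y / μ x) • x) (by simp; field_simp)
    have a2 := key x hx hfx hgx ((μ y / μ x)⁻¹ • y) (by simp; field_simp)
    rw [h.smul _ _ (inv_nonneg.2 hs.le)] at a2
    rw [h.smul _ _ hs.le] at a1
    have h3 := mul_le_mul_of_nonneg_left a2 hs.le
    rw [← mul_assoc, mul_inv_cancel₀ hs.ne', one_mul] at h3
    have h4 : Φ x / μ x * μ y = μ y / μ x * Φ x := by ring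
    rw [h4]
    linarith

lemma DC_stepM (hV : Module.finrank ℝ V = 3) {Φ : V → ℝ} (h : DCNm Φ) {f0 f1 : V →L[ℝ] ℝ} {e : V}
    (hf0 : DCD Φ f0 e) (hf1 : DCD Φ f1 e) (h0 : f0 e = 1) (h1 : f1 e = 1) (hne : f0 ≠ f1)
    (hN : ∀ᶠ ξ in nhds f0, ∃ e' : V, e' ≠ 0 ∧ DCD Φ ξ e') :
    ∃ (f2 : V →L[ℝ] ℝ) (x0 : V), DCD Φ f2 e ∧ f2 e = 1 ∧ f0 x0 = 0 ∧ f1 x0 = 1 ∧ f2 x0 = -1 := by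
  have he : e ≠ 0 := by rintro rfl; simp at h1
  obtain ⟨s, hs0, hs1, hsN⟩ : ∃ s : ℝ, 0 < s ∧ s < 1 ∧
      ∀ᶠ ξ in nhds (f0 + s • (f1 - f0)), ∃ e' : V, e' ≠ 0 ∧ DCD Φ ξ e' := by
    have hN' := hN.eventually_nhds
    have ht : Filter.Tendsto (fun s : ℝ => f0 + s • (f1 - f0)) (nhdsWithin 0 (Set.Ioi 0)) (nhds f0) := by
      have : Continuous (fun s : ℝ => f0 + s • (f1 - f0)) := by fun_prop
      have := this.tendsto 0
      simp only [zero_smul, add_zero] at this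
      exact this.mono_left nhdsWithin_le_nhds
    have h3 : ∀ᶠ s : ℝ in nhdsWithin 0 (Set.Ioi 0), s ∈ Set.Ioo (0:ℝ) 1 :=
      Ioo_mem_nhdsGT one_pos
    obtain ⟨s, a, b⟩ := ((ht.eventually hN').and h3).exists
    exact ⟨s, b.1, b.2, a⟩
  obtain ⟨q', hq'⟩ : ∃ q', (f1 - f0) q' ≠ 0 := by
    by_contra hc
    push Not at hc
    apply hne
    ext v
    have := hc v
    simp only [sub_apply] at this
    linarith
  set d := f1 - f0 with hd
  have hde : d e = 0 := by simp [hd, h0, h1]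
  have hf1d : f1 = f0 + d := by simp [hd]
  -- q
  obtain ⟨q, hq1, hq2⟩ : ∃ q, d q = 1 ∧ f0 q = -s := by
    refine ⟨(d q')⁻¹ • q' + (-s - f0 ((d q')⁻¹ • q')) • e, ?_, ?_⟩
    · simp [hde, hq']
    · rw [map_add, map_smul _ _ e, h0]; simp
  obtain ⟨p, hp, hp0, hp1⟩ := DC_ker2 hV f0 d
  obtain ⟨H, -, -, ⟨hHp, hHq, hHe⟩, -, -, -⟩ := DC_basis3 hV p q e (by
    intro r t u hh
    have a1 := congrArg d hh
    have a2 := congrArg f0 hh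
    simp [hp1, hq1, hde] at a1
    simp [hp0, hq2, h0, a1] at a2
    simp [a1, a2, hp] at hh
    exact ⟨hh, a1, a2⟩)
  obtain ⟨δ, hδ, hδG⟩ : ∃ δ : ℝ, δ ≠ 0 ∧ DCD Φ (f0 + s • d + δ • H) e := by
    by_contra hcon
    push Not at hcon
    have hk : 0 < min s (1 - s) / 2 := by
      have : 0 < min s (1 - s) := lt_min hs0 (by linarith)
      linarith
    set k := min s (1 - s) / 2 with hkd
    have hks : k < s := by have := min_le_left s (1 - s); linarith
    have hks' : k < 1 - s := by have := min_le_right s (1 - s); linarith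
    have ht : Filter.Tendsto (fun η : ℝ => f0 + s • d + (k * η) • H) (nhdsWithin 0 (Set.Ioi 0))
        (nhds (f0 + s • d)) := by
      have : Continuous (fun η : ℝ => f0 + s • d + (k * η) • H) := by fun_prop
      have := this.tendsto 0
      simp only [mul_zero, zero_smul, add_zero] at this
      exact this.mono_left nhdsWithin_le_nhds
    have ht2 : ∀ᶠ η : ℝ in nhdsWithin 0 (Set.Ioi 0), η * (2 * Φ q + Φ (-q) + k * Φ e) < Φ p := by
      have : Continuous (fun η : ℝ => η * (2 * Φ q + Φ (-q) + k * Φ e)) := by fun_prop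
      have := this.tendsto 0
      simp only [zero_mul] at this
      exact (this.mono_left nhdsWithin_le_nhds).eventually (gt_mem_nhds (h.pos p hp))
    obtain ⟨η, ⟨⟨e', he', hD⟩, hη⟩, hη0⟩ :=
      (((ht.eventually hsN).and ht2).and self_mem_nhdsWithin).exists
    have hη0 : 0 < η := hη0
    obtain ⟨l, hle, hl, hlx⟩ := DC_lemF hV h hf0 hf1 h0 h1 hD he'
      (hcon (k * η) (by positivity))
    have a1 := mul_pos hk hη0
    have a2 : k * η < s * η := by gcongr
    have a3 : k * η < (1 - s) * η := by gcongr
    have x1 := hlx (p + η • q - (k * η) • e)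
      (by simp [hp0, hp1, hHp, h0, hq1, hq2, hHq, hde, hHe]; ring)
      (by simp [hp0, hq2, h0]; nlinarith)
      (by rw [hf1d]; simp [hp0, hq2, h0, hp1, hq1, hde]; nlinarith)
    have x2 := hlx (-p + η • q + (k * η) • e)
      (by simp [hp0, hp1, hHp, h0, hq1, hq2, hHq, hde, hHe]; ring)
      (by simp [hp0, hq2, h0]; nlinarith)
      (by rw [hf1d]; simp [hp0, hq2, h0, hp1, hq1, hde]; nlinarith)
    have x3 : Φ (p + η • q - (k * η) • e) ≤ 2 * η * Φ q := by
      have y1 := h.nonneg (-p + η • q + (k * η) • e)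
      have y2 := hl ((2 * η) • q)
      rw [h.smul _ _ (by positivity)] at y2
      have y3 : l ((2 * η) • q) = l (p + η • q - (k * η) • e) + l (-p + η • q + (k * η) • e) := by
        rw [← map_add]; congr 1; module
      linarith
    have x4 : Φ p ≤ Φ (p + η • q - (k * η) • e) + η * Φ (-q) + (k * η) * Φ e := by
      have y1 := h.add (p + η • q - (k * η) • e) (η • (-q) + (k * η) • e)
      have y2 := h.conv (a := η) (b := k * η) hη0.le a1.le (-q) e
      have y3 : p + η • q - (k * η) • e + (η • (-q) + (k * η) • e) = p := by module
      rw [y3] at y1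
      linarith
    nlinarith
  refine ⟨f0 + s • d + δ • H, q + (-(1 + s) / δ) • p + s • e, hδG, ?_, ?_, ?_, ?_⟩
  · simp [h0, hde, hHe]
  · simp [hq2, hp0, h0]
  · rw [hf1d]; simp [hq2, hp0, h0, hq1, hp1, hde]
  · simp [hq2, hp0, h0, hq1, hp1, hde, hHp, hHq, hHe]; field_simp; ring

lemma DC_stepO (hV : Module.finrank ℝ V = 3) {Φ : V → ℝ} (h : DCNm Φ) {f0 f1 f2 : V →L[ℝ] ℝ}
    {e x0 : V} (h0 : f0 e = 1)
    (hf1 : DCD Φ f1 e) (hf2 : DCD Φ f2 e) (h1 : f1 e = 1) (h2 : f2 e = 1)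
    (hx0 : f0 x0 = 0) (hx1 : f1 x0 = 1) (hx2 : f2 x0 = -1)
    (hN : ∀ᶠ ξ in nhds f0, ∃ e' : V, e' ≠ 0 ∧ DCD Φ ξ e')
    (hnot : ¬ ∀ᶠ ξ in nhds f0, DCD Φ ξ e) :
    ∃ l : V →L[ℝ] ℝ, l e = 0 ∧ (∀ v, l v ≤ Φ v) ∧ ∀ᶠ v in nhds x0, Φ v = l v := by
  have ca : ∀ v : V, Continuous (fun ξ : V →L[ℝ] ℝ => ξ v) := fun v => by fun_prop
  have c1 : ∀ᶠ ξ in nhds f0, ξ e ≠ 0 := by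
    have := (ca e).continuousAt (x := f0)
    exact this.eventually_ne (by simp [h0])
  have c2 : Filter.Tendsto (fun ξ : V →L[ℝ] ℝ => x0 - (ξ x0 / ξ e) • e) (nhds f0) (nhds x0) := by
    have : ContinuousAt (fun ξ : V →L[ℝ] ℝ => x0 - (ξ x0 / ξ e) • e) f0 := by
      refine continuousAt_const.sub ((ContinuousAt.div (ca x0).continuousAt (ca e).continuousAt
        (by simp [h0])).smul continuousAt_const)
    have := this.tendsto
    simpa [hx0] using this
  have c3 : ∀ᶠ v in nhds x0, f2 v < 0 ∧ 0 < f1 v := by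
    refine (f2.continuous.continuousAt.eventually (gt_mem_nhds (by simp [hx2]))).and
      (f1.continuous.continuousAt.eventually (lt_mem_nhds (by simp [hx1])))
  rw [Filter.not_eventually] at hnot
  obtain ⟨ξ, hξ, ⟨⟨hξe, hξx⟩, e', he', hD⟩⟩ :=
    (hnot.and_eventually ((c1.and (c2.eventually c3)).and hN)).exists
  obtain ⟨l, hle, hl, hlx⟩ := DC_lemF hV h hf2 hf1 h2 h1 hD he' hξ
  refine ⟨l, hle, hl, ?_⟩
  have c4 : ∀ᶠ v in nhds x0, f2 (v - (ξ v / ξ e) • e) < 0 ∧ 0 < f1 (v - (ξ v / ξ e) • e) := by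
    have : Continuous (fun v => (v - (ξ v / ξ e) • e)) := by fun_prop
    refine ((f2.continuous.comp this).continuousAt.eventually (gt_mem_nhds hξx.1)).and
      ((f1.continuous.comp this).continuousAt.eventually (lt_mem_nhds hξx.2))
  filter_upwards [c3, c4] with v hv hv'
  have y1 := hlx (v - (ξ v / ξ e) • e) (by simp; field_simp; ring) hv'.1 hv'.2
  have y2 := (DC_flat_eq h hf2 hf1 h2 h1 v hv.1 hv.2).2
  have y3 := (DC_flat_eq h hf2 hf1 h2 h1 _ hv'.1 hv'.2).2
  have y4 : v - (ξ v / ξ e) • e - f1 (v - (ξ v / ξ e) • e) • e = v - f1 v • e := by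
    simp only [map_sub, map_smul, h1, smul_eq_mul]; module
  rw [y4] at y3
  rw [← y2, y3, y1]
  simp [hle]

lemma DC_projF {Φ : V → ℝ} {ξ l : V →L[ℝ] ℝ} {e : V} (hd : DCD Φ ξ e) (hne : ξ e ≠ 0)
    (hl : ∀ v, l v ≤ Φ v) (hle : l e = 0) {v : V} (hv : Φ v = l v) :
    Φ (v - (ξ v / ξ e) • e) = l (v - (ξ v / ξ e) • e) := by
  apply le_antisymm _ (hl _)
  have := hd.proj hne v
  simp only [map_sub, map_smul, hle, smul_eq_mul, mul_zero, sub_zero]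
  linarith

lemma DC_stepP (hV : Module.finrank ℝ V = 3) {Φ : V → ℝ} (h : DCNm Φ) {f0 f1 l : V →L[ℝ] ℝ}
    {e x0 : V} (hf0 : DCD Φ f0 e)
    (hf1 : DCD Φ f1 e) (h0 : f0 e = 1) (h1 : f1 e = 1)
    (hx0 : f0 x0 = 0) (hx1 : f1 x0 = 1)
    (hle : l e = 0) (hl : ∀ v, l v ≤ Φ v) (hlx : ∀ᶠ v in nhds x0, Φ v = l v)
    (hN : ∀ᶠ ξ in nhds f0, ∃ e' : V, e' ≠ 0 ∧ DCD Φ ξ e') :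
    ∀ᶠ ξ in nhds f0, DCD Φ ξ e := by
  have he : e ≠ 0 := by rintro rfl; simp at h1
  have hx0ne : x0 ≠ 0 := by rintro rfl; simp at hx1
  have hL : 0 < l x0 := by
    rw [← hlx.self_of_nhds]; exact h.pos _ hx0ne
  obtain ⟨p, hp, hp0, hpl⟩ := DC_ker2 hV f0 l
  obtain ⟨α, κ, γ, hα, hκ, hγ, hdec⟩ := DC_basis3 hV x0 p e (by
    intro r t u hh
    have a1 := congrArg l hh
    have a2 := congrArg f0 hh
    simp [hpl, hle, hL.ne'] at a1
    simp [hp0, h0, hx0] at a2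
    simp [a1, a2, hp] at hh
    exact ⟨a1, hh, a2⟩)
  have hγf : ∀ v, γ v = f0 v := by
    intro v
    have := congrArg f0 (hdec v)
    simp [hx0, hp0, h0] at this
    exact this.symm
  have hαl : ∀ v, l v = α v * l x0 := by
    intro v
    have := congrArg l (hdec v)
    simpa [hpl, hle] using this
  have ca : ∀ v : V, Continuous (fun ξ : V →L[ℝ] ℝ => ξ v) := fun v => by fun_prop
  have N1 : ∀ᶠ ξ in nhds f0, ∃ e' : V, e' ≠ 0 ∧ DCD Φ ξ e' ∧ l e' = 0 := by
    have c1 : ∀ᶠ ξ in nhds f0, ξ e ≠ 0 := by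
      have := (ca e).continuousAt (x := f0)
      exact this.eventually_ne (by simp [h0])
    have c2 : Filter.Tendsto (fun ξ : V →L[ℝ] ℝ => x0 - (ξ x0 / ξ e) • e) (nhds f0) (nhds x0) := by
      have : ContinuousAt (fun ξ : V →L[ℝ] ℝ => x0 - (ξ x0 / ξ e) • e) f0 := by
        refine continuousAt_const.sub ((ContinuousAt.div (ca x0).continuousAt (ca e).continuousAt
          (by simp [h0])).smul continuousAt_const)
      have := this.tendsto
      simpa [hx0] using this
    filter_upwards [c1, c2.eventually hlx.eventually_nhds, hN] with ξ hξ hy hD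
    obtain ⟨e', he', hD⟩ := hD
    refine ⟨e', he', hD, ?_⟩
    set y := x0 - (ξ x0 / ξ e) • e with hyd
    have hy0 : ξ y = 0 := by simp [hyd]; field_simp; ring
    have ht : Filter.Tendsto (fun t : ℝ => y + t • e') (nhds 0) (nhds y) := by
      have : Continuous (fun t : ℝ => y + t • e') := by fun_prop
      have := this.tendsto 0
      simpa using this
    have hev : ∀ᶠ t : ℝ in nhds 0, 0 ≤ t * l e' := by
      filter_upwards [ht.eventually hy] with t h3
      have h4 := hD y hy0 t
      rw [h3, hy.self_of_nhds] at h4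
      simpa using h4
    obtain ⟨ε, hε, hb⟩ := Metric.eventually_nhds_iff.1 hev
    have b1 := hb (y := ε / 2) (by simp [abs_of_pos hε]; linarith)
    have b2 := hb (y := -(ε / 2)) (by simp [abs_of_pos hε]; linarith)
    have : ε / 2 * l e' = 0 := by linarith
    rcases mul_eq_zero.1 this with h | h
    · linarith
    · exact h
  -- the face
  set E : Set V := {v | Φ v = l v ∧ l v = l x0} with hE
  have hEc : IsCompact E := by
    obtain ⟨m, hm, hlow⟩ := h.lower
    refine Metric.isCompact_of_isClosed_isBounded ?_ ?_
    · exact (isClosed_eq h.cont l.continuous).inter (isClosed_eq l.continuous continuous_const)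
    · refine (Metric.isBounded_closedBall (x := (0:V)) (r := l x0 / m)).subset ?_
      intro v hv
      rw [mem_closedBall_zero_iff, le_div_iff₀ hm]
      have := hlow v
      rw [hv.1, hv.2] at this
      linarith
  have hx0E : x0 ∈ E := ⟨hlx.self_of_nhds, rfl⟩
  have hEproj : ∀ v ∈ E, ∀ (ξ : V →L[ℝ] ℝ) (e' : V), e' ≠ 0 → DCD Φ ξ e' → l e' = 0 →
      v - (ξ v / ξ e') • e' ∈ E := by
    intro v hv ξ e' he' hD hl'
    refine ⟨DC_projF hD (hD.ne h he') hl hl' hv.1, ?_⟩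
    simp [hl', hv.2]
  have hαE : ∀ v ∈ E, α v = 1 := by
    intro v hv
    have := hαl v
    rw [hv.2] at this
    have h3 : (α v - 1) * l x0 = 0 := by linarith
    rcases mul_eq_zero.1 h3 with h | h <;> linarith
  have vert : ∀ c, ((∀ v ∈ E, κ v ≤ κ c) ∨ (∀ v ∈ E, κ c ≤ κ v)) →
      ∀ t1 t2 : ℝ, c + t1 • e ∈ E → c + t2 • e ∈ E → ∀ (ξ : V →L[ℝ] ℝ),
      (∃ e' : V, e' ≠ 0 ∧ DCD Φ ξ e' ∧ l e' = 0) →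
      ξ (c + t1 • e) < 0 → 0 < ξ (c + t2 • e) → DCD Φ ξ e := by
    rintro c hc t1 t2 hc1 hc2 ξ ⟨e', he', hD, hl'⟩ hs1 hs2
    have hα' : α e' = 0 := by
      have := hαl e'
      rw [hl'] at this
      rcases mul_eq_zero.1 this.symm with h | h
      · exact h
      · linarith
    have hξe' := hD.ne h he'
    by_cases hk : κ e' = 0
    · have hd := hdec e'
      rw [hk, hα', zero_smul, zero_smul, zero_add, zero_add] at hd
      have hne : γ e' ≠ 0 := by
        intro h3; rw [h3, zero_smul] at hd; exact he' hd
      intro x hx r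
      have := hD x hx (r / γ e')
      rw [hd, smul_smul] at this
      have e3 : r / γ (γ e' • e) * γ e' = r := by
        rw [← hd]; field_simp
      rwa [e3] at this
    · exfalso
      have k1 := hEproj _ hc1 ξ e' he' hD hl'
      have k2 := hEproj _ hc2 ξ e' he' hD hl'
      set k := κ e' / ξ e' with hkd
      have hk0 : k ≠ 0 := div_ne_zero hk hξe'
      have m1 : ∀ t : ℝ, κ (c + t • e - (ξ (c + t • e) / ξ e') • e') = κ c - ξ (c + t • e) * k := by
        intro t
        rw [map_sub, map_smul, map_add, map_smul, hκ.2.2]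
        simp [hkd]; ring
      rcases hc with hc | hc
      · have n1 := hc _ k1
        have n2 := hc _ k2
        rw [m1] at n1 n2
        rcases lt_or_gt_of_ne hk0 with h3 | h3 <;> nlinarith
      · have n1 := hc _ k1
        have n2 := hc _ k2
        rw [m1] at n1 n2
        rcases lt_or_gt_of_ne hk0 with h3 | h3 <;> nlinarith
  have main : ∀ a b, a ∈ E → b ∈ E → f0 a = 0 → f0 b = 0 →
      ((∀ v ∈ E, κ v ≤ κ a) ∨ (∀ v ∈ E, κ a ≤ κ v)) →
      ((∀ v ∈ E, κ v ≤ κ b) ∨ (∀ v ∈ E, κ b ≤ κ v)) → κ a ≠ κ b → f1 b ≠ 0 →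
      ∀ᶠ ξ in nhds f0, DCD Φ ξ e := by
    intro a b ha hb ha0 hb0 hca hcb hab hfb
    have hb1 : b + (-f1 b) • e ∈ E := by
      have := hEproj b hb f1 e he hf1 hle
      rw [h1, div_one] at this
      rwa [neg_smul, ← sub_eq_add_neg]
    have hb2 : b + (0:ℝ) • e ∈ E := by simpa using hb
    have hab' : κ b - κ a ≠ 0 := sub_ne_zero.2 (Ne.symm hab)
    have tilt : ∀ σ : ℝ, ∀ᶠ r : ℝ in nhdsWithin 0 (Set.Ioi 0), a + (r * σ) • e ∈ E := by
      intro σ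
      have ht : Filter.Tendsto (fun r : ℝ => f0 + r • (((f1 b + σ) / (κ b - κ a)) • κ +
          (f1 b - (f1 b + σ) / (κ b - κ a) * κ b) • α)) (nhdsWithin 0 (Set.Ioi 0)) (nhds f0) := by
        have : Continuous (fun r : ℝ => f0 + r • (((f1 b + σ) / (κ b - κ a)) • κ +
          (f1 b - (f1 b + σ) / (κ b - κ a) * κ b) • α)) := by fun_prop
        have := this.tendsto 0
        simp only [zero_smul, add_zero] at this
        exact this.mono_left nhdsWithin_le_nhds
      have h3 : ∀ᶠ s : ℝ in nhdsWithin 0 (Set.Ioi 0), s ∈ Set.Ioo (0:ℝ) 1 :=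
        Ioo_mem_nhdsGT one_pos
      filter_upwards [ht.eventually N1, h3] with r hr hr1
      set ξ := f0 + r • (((f1 b + σ) / (κ b - κ a)) • κ +
          (f1 b - (f1 b + σ) / (κ b - κ a) * κ b) • α) with hξ
      have v1 : ξ e = 1 := by simp [hξ, h0, hα.2.2, hκ.2.2]
      have v2 : ξ b = r * f1 b := by
        simp [hξ, hb0, hαE b hb]; ring
      have v3 : ξ a = - (r * σ) := by
        simp [hξ, ha0, hαE a ha]; field_simp; ring
      have hD : DCD Φ ξ e := by
        rcases lt_or_gt_of_ne hfb with h4 | h4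
        · refine vert b hcb 0 (-f1 b) hb2 hb1 ξ hr ?_ ?_
          · simp [v2]; nlinarith [hr1.1]
          · simp [v2, v1]; nlinarith [hr1.2]
        · refine vert b hcb (-f1 b) 0 hb1 hb2 ξ hr ?_ ?_
          · simp [v2, v1]; nlinarith [hr1.2]
          · rw [zero_smul, add_zero, v2]; exact mul_pos hr1.1 h4
      have := hEproj a ha ξ e he hD hle
      rw [v1, v3, div_one, neg_smul, sub_neg_eq_add] at this
      exact this
    obtain ⟨r, ⟨r1, r2⟩, hr⟩ := (((tilt (-1)).and (tilt 1)).and self_mem_nhdsWithin).exists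
    have hr : 0 < r := hr
    have g1 : ∀ᶠ ξ in nhds f0, ξ (a + (r * -1) • e) < 0 :=
      (ca _).continuousAt.eventually (gt_mem_nhds (by simp [ha0, h0, hr]))
    have g2 : ∀ᶠ ξ in nhds f0, 0 < ξ (a + (r * 1) • e) :=
      (ca _).continuousAt.eventually (lt_mem_nhds (by simp [ha0, h0, hr]))
    filter_upwards [g1, g2, N1] with ξ a1 a2 a3
    exact vert a hca _ _ r1 r2 ξ a3 a1 a2
  have pr0 : ∀ v ∈ E, v - f0 v • e ∈ E ∧ f0 (v - f0 v • e) = 0 ∧ κ (v - f0 v • e) = κ v := by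
    intro v hv
    have := hEproj v hv f0 e he hf0 hle
    rw [h0, div_one] at this
    refine ⟨this, by simp [h0], by simp [hκ.2.2]⟩
  obtain ⟨b', hb', hbmax⟩ := hEc.exists_isMaxOn ⟨x0, hx0E⟩ κ.continuous.continuousOn
  obtain ⟨a', ha', hamin⟩ := hEc.exists_isMinOn ⟨x0, hx0E⟩ κ.continuous.continuousOn
  obtain ⟨hb, hb0, hbκ⟩ := pr0 b' hb'
  obtain ⟨ha, ha0, haκ⟩ := pr0 a' ha'
  set b := b' - f0 b' • e
  set a := a' - f0 a' • e
  have hcb : ∀ v ∈ E, κ v ≤ κ b := by intro v hv; rw [hbκ]; exact hbmax hv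
  have hca : ∀ v ∈ E, κ a ≤ κ v := by intro v hv; rw [haκ]; exact hamin hv
  have hab : κ a < κ b := by
    have ht : Filter.Tendsto (fun t : ℝ => x0 + t • p) (nhdsWithin 0 (Set.Ioi 0)) (nhds x0) := by
      have : Continuous (fun t : ℝ => x0 + t • p) := by fun_prop
      have := this.tendsto 0
      simp only [zero_smul, add_zero] at this
      exact this.mono_left nhdsWithin_le_nhds
    obtain ⟨t, ht1, ht2⟩ := ((ht.eventually hlx).and self_mem_nhdsWithin).exists
    have ht2 : 0 < t := ht2
    have hm : x0 + t • p ∈ E := ⟨ht1, by simp [hpl]⟩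
    have n1 := hcb _ hm
    have n2 := hca _ hx0E
    simp [hκ.1, hκ.2.1] at n1 n2
    linarith
  by_cases hfb : f1 b = 0
  · by_cases hfa : f1 a = 0
    · exfalso
      have d1 := congrArg f1 (hdec b)
      have d2 := congrArg f1 (hdec a)
      simp [hαE b hb, hγf, hb0, hfb, hx1] at d1
      simp [hαE a ha, hγf, ha0, hfa, hx1] at d2
      have : (κ b - κ a) * f1 p = 0 := by linarith
      rcases mul_eq_zero.1 this with h3 | h3
      · linarith
      · simp [h3] at d1
    · exact main b a hb ha hb0 ha0 (Or.inl hcb) (Or.inr hca) hab.ne' hfa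
  · exact main a b ha hb ha0 hb0 (Or.inr hca) (Or.inl hcb) hab.ne hfb

theorem DC_core (hV : Module.finrank ℝ V = 3) {Φ : V → ℝ} (h : DCNm Φ) {f0 f1 : V →L[ℝ] ℝ} {e : V}
    (hf0 : DCD Φ f0 e) (hf1 : DCD Φ f1 e) (h0 : f0 e = 1) (h1 : f1 e = 1) (hne : f0 ≠ f1)
    (hN : ∀ᶠ ξ in nhds f0, ∃ e' : V, e' ≠ 0 ∧ DCD Φ ξ e') :
    ∀ᶠ ξ in nhds f0, DCD Φ ξ e := by
  by_contra hcon
  obtain ⟨f2, x0, hf2, h2, y0, y1, y2⟩ := DC_stepM hV h hf0 hf1 h0 h1 hne hN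
  obtain ⟨l, hle, hl, hlx⟩ := DC_stepO hV h h0 hf1 hf2 h1 h2 y0 y1 y2 hN hcon
  exact hcon (DC_stepP hV h hf0 hf1 h0 h1 y0 y1 hle hl hlx hN)

lemma DC_kerK (hV : Module.finrank ℝ V = 3) {Y : Submodule ℝ V} (hY : Module.finrank ℝ Y = 2)
    {ξ : V →L[ℝ] ℝ} {w : V} (hw : ξ w ≠ 0) (hle : ∀ z ∈ Y, ξ z = 0) : ∀ z, z ∈ Y ↔ ξ z = 0 := by
  have h1 : (ξ : V →ₗ[ℝ] ℝ) ≠ 0 := by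
    intro h
    apply hw
    have := congrArg (fun f : V →ₗ[ℝ] ℝ => f w) h
    simpa using this
  have h2 := Module.Dual.finrank_ker_add_one_of_ne_zero (f := (ξ : V →ₗ[ℝ] ℝ)) h1
  have h3 : Y = LinearMap.ker (ξ : V →ₗ[ℝ] ℝ) := by
    apply Submodule.eq_of_le_of_finrank_eq
    · intro z hz
      simpa using hle z hz
    · rw [hV] at h2
      omega
  intro z
  rw [h3]
  simp

lemma DC_rep (hV : Module.finrank ℝ V = 3) (X : Gr 2 V) {e : V} (he : e ∉ X.1) :
    ∃ ξ : V →L[ℝ] ℝ, ξ e = 1 ∧ ∀ v, v ∈ X.1 ↔ ξ v = 0 := by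
  obtain ⟨f, hf, hle⟩ := Submodule.exists_le_ker_of_notMem he
  have h1 : ((f e)⁻¹ • LinearMap.toContinuousLinearMap f) e = 1 := by
    simp [hf]
  refine ⟨(f e)⁻¹ • LinearMap.toContinuousLinearMap f, h1, ?_⟩
  refine DC_kerK hV X.2 (w := e) (by rw [h1]; exact one_ne_zero) ?_
  intro z hz
  have : f z = 0 := hle hz
  simp [this]

lemma DC_basisX (X : Gr 2 V) : ∃ u : Fin 2 → V, LinearIndependent ℝ u ∧
    Submodule.span ℝ (Set.range u) = X.1 := by
  let b := Module.finBasisOfFinrankEq ℝ X.1 X.2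
  refine ⟨fun i => (b i : V), ?_, ?_⟩
  · exact b.linearIndependent.map' X.1.subtype (Submodule.ker_subtype _)
  · have h1 : Set.range (fun i => (b i : V)) = X.1.subtype '' Set.range b := by
      rw [← Set.range_comp]; rfl
    rw [h1, Submodule.span_image, b.span_eq, Submodule.map_top, Submodule.range_subtype]

lemma DC_T1 (hV : Module.finrank ℝ V = 3) {U : Set (Gr 2 V)} (hU : IsOpen U) {X : Gr 2 V}
    (hX : X ∈ U) {ξ0 : V →L[ℝ] ℝ} {w : V} (hw : ξ0 w = 1) (hk : ∀ v, v ∈ X.1 ↔ ξ0 v = 0) :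
    ∀ᶠ ξ in nhds ξ0, ∃ Y ∈ U, ∀ v, v ∈ Y.1 ↔ ξ v = 0 := by
  obtain ⟨u, hu, hspan⟩ := DC_basisX X
  have hu0 : ∀ i, ξ0 (u i) = 0 := by
    intro i
    rw [← hk, ← hspan]
    exact Submodule.subset_span ⟨i, rfl⟩
  have hop := isOpen_coinduced.1 hU
  obtain ⟨O, hO, hOU⟩ := isOpen_induced_iff.1 hop
  have ca : ∀ v : V, Continuous (fun ξ : V →L[ℝ] ℝ => ξ v) := fun v => by fun_prop
  have c1 : ∀ᶠ ξ in nhds ξ0, ξ w ≠ 0 := by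
    have := (ca w).continuousAt (x := ξ0)
    exact this.eventually_ne (by simp [hw])
  have c2 : Filter.Tendsto (fun ξ : V →L[ℝ] ℝ => fun i => u i - (ξ (u i) / ξ w) • w)
      (nhds ξ0) (nhds u) := by
    rw [tendsto_pi_nhds]
    intro i
    have : ContinuousAt (fun ξ : V →L[ℝ] ℝ => u i - (ξ (u i) / ξ w) • w) ξ0 := by
      refine continuousAt_const.sub ((ContinuousAt.div (ca _).continuousAt (ca w).continuousAt
        (by simp [hw])).smul continuousAt_const)
    have := this.tendsto
    simpa [hu0] using this
  have huO : u ∈ O := by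
    have : (⟨u, hu⟩ : {v : Fin 2 → V // LinearIndependent ℝ v}) ∈ Subtype.val ⁻¹' O := by
      rw [hOU]
      show (⟨Submodule.span ℝ (Set.range u), _⟩ : Gr 2 V) ∈ U
      have h3 : (⟨Submodule.span ℝ (Set.range u), by
          rw [finrank_span_eq_card hu, Fintype.card_fin]⟩ : Gr 2 V) = X := Subtype.ext hspan
      rw [h3]; exact hX
    exact this
  filter_upwards [c1, c2.eventually (hO.mem_nhds huO)] with ξ hξ hmem
  have hli : LinearIndependent ℝ (fun i => u i - (ξ (u i) / ξ w) • w) := by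
    rw [Fintype.linearIndependent_iff] at hu ⊢
    intro g hg
    apply hu
    have h5 := congrArg ξ0 hg
    simp only [Fin.sum_univ_two] at hg h5 ⊢
    simp [hu0, hw] at h5
    have h6 : g 0 • u 0 + g 1 • u 1 = (g 0 * (ξ (u 0) / ξ w) + g 1 * (ξ (u 1) / ξ w)) • w := by
      rw [← sub_eq_zero, ← hg]; module
    rw [h6]
    have h7 : g 0 * (ξ (u 0) / ξ w) + g 1 * (ξ (u 1) / ξ w) = 0 := by linarith
    rw [h7, zero_smul]
  have hfr : Module.finrank ℝ (Submodule.span ℝ (Set.range (fun i => u i - (ξ (u i) / ξ w) • w)))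
      = 2 := by
    rw [finrank_span_eq_card hli, Fintype.card_fin]
  refine ⟨⟨Submodule.span ℝ (Set.range (fun i => u i - (ξ (u i) / ξ w) • w)), hfr⟩, ?_, ?_⟩
  · have : (⟨_, hli⟩ : {v : Fin 2 → V // LinearIndependent ℝ v}) ∈ Subtype.val ⁻¹' O := hmem
    rw [hOU] at this
    exact this
  · refine DC_kerK hV hfr hξ ?_
    intro z hz
    have : Submodule.span ℝ (Set.range (fun i => u i - (ξ (u i) / ξ w) • w)) ≤
        LinearMap.ker (ξ : V →ₗ[ℝ] ℝ) := by
      rw [Submodule.span_le]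
      rintro _ ⟨i, rfl⟩
      simp
      field_simp
      ring
    simpa using this hz

lemma DC_T2 (hV : Module.finrank ℝ V = 3) {A : Set (Gr 2 V)}
    (hA : ∀ X ∈ A, ∃ ξ0 : V →L[ℝ] ℝ, ∃ w, ξ0 w = 1 ∧ (∀ v, v ∈ X.1 ↔ ξ0 v = 0) ∧
      ∀ᶠ ξ in nhds ξ0, ∀ Y : Gr 2 V, (∀ v, v ∈ Y.1 ↔ ξ v = 0) → Y ∈ A) : IsOpen A := by
  refine isOpen_coinduced.2 ?_
  rw [isOpen_iff_mem_nhds]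
  rintro ⟨u, hu⟩ hmem
  obtain ⟨ξ0, w, hw, hk, hev⟩ := hA _ hmem
  have hu0 : ∀ i, ξ0 (u i) = 0 := by
    intro i
    rw [← hk]
    exact Submodule.subset_span ⟨i, rfl⟩
  obtain ⟨α, β, γ, hα, hβ, hγ, hdec⟩ := DC_basis3 hV (u 0) (u 1) w (by
    intro r s t hh
    have h5 := congrArg ξ0 hh
    simp [hu0, hw] at h5
    rw [h5, zero_smul, add_zero] at hh
    rw [Fintype.linearIndependent_iff] at hu
    have := hu ![r, s] (by simpa [Fin.sum_univ_two] using hh)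
    exact ⟨this 0, this 1, h5⟩)
  have hγ0 : γ = ξ0 := by
    ext v
    have := congrArg ξ0 (hdec v)
    simp [hu0, hw] at this
    exact this.symm
  let Ψ : (Fin 2 → V) → (V →L[ℝ] ℝ) := fun z =>
    (β (z 0) * γ (z 1) - γ (z 0) * β (z 1)) • α + (γ (z 0) * α (z 1) - α (z 0) * γ (z 1)) • β +
    (α (z 0) * β (z 1) - β (z 0) * α (z 1)) • γ
  have hΨc : Continuous Ψ := by
    show Continuous (fun z : Fin 2 → V =>
    (β (z 0) * γ (z 1) - γ (z 0) * β (z 1)) • α + (γ (z 0) * α (z 1) - α (z 0) * γ (z 1)) • β +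
    (α (z 0) * β (z 1) - β (z 0) * α (z 1)) • γ)
    fun_prop
  have hΨu : Ψ u = ξ0 := by
    simp [Ψ, hα, hβ, hγ, hγ0.symm]
  have ht : Filter.Tendsto (fun z : {v : Fin 2 → V // LinearIndependent ℝ v} => Ψ z.1)
      (nhds ⟨u, hu⟩) (nhds ξ0) := by
    have := (hΨc.comp continuous_subtype_val).tendsto
      (⟨u, hu⟩ : {v : Fin 2 → V // LinearIndependent ℝ v})
    simp only [Function.comp_apply, hΨu] at this
    exact this
  have c1 : ∀ᶠ ξ : V →L[ℝ] ℝ in nhds ξ0, ξ w ≠ 0 := by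
    have : Continuous (fun ξ : V →L[ℝ] ℝ => ξ w) := by fun_prop
    exact (this.continuousAt (x := ξ0)).eventually_ne (by simp [hw])
  filter_upwards [ht.eventually c1, ht.eventually hev] with z hz1 hz2
  apply hz2
  refine DC_kerK hV ?_ hz1 ?_
  · rw [finrank_span_eq_card z.2, Fintype.card_fin]
  · intro v hv
    have : Submodule.span ℝ (Set.range z.1) ≤ LinearMap.ker ((Ψ z.1 : V →L[ℝ] ℝ) : V →ₗ[ℝ] ℝ) := by
      rw [Submodule.span_le]
      rintro _ ⟨i, rfl⟩
      fin_cases i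
      · simp [Ψ]; ring
      · simp [Ψ]; ring
    simpa using this hv


lemma DC_gauge {B : Set V} (hB : IsConvexBody B) (h0 : 0 ∈ interior B) : DCNm (gauge B) := by
  have hn : B ∈ nhds (0:V) := mem_interior_iff_mem_nhds.1 h0
  have habs : Absorbent ℝ B := absorbent_nhds_zero hn
  refine ⟨gauge_add_le hB.2.1 habs, ?_, ?_, continuous_gauge hB.2.1 hn, ?_⟩
  · intro c v hc
    rw [gauge_smul_of_nonneg hc, smul_eq_mul]
  · intro v hv
    exact (gauge_pos habs (NormedSpace.isVonNBounded_iff ℝ |>.2 hB.1.isBounded)).2 hv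
  · obtain ⟨r, hr, hsub⟩ := hB.1.isBounded.subset_closedBall_lt 0 0
    refine ⟨r⁻¹, by positivity, fun v => ?_⟩
    have := le_gauge_of_subset_closedBall (x := v) habs hr.le hsub
    rwa [div_eq_inv_mul] at this

lemma DC_C1 (hV : Module.finrank ℝ V = 3) {B : Set V} (hB : IsConvexBody B)
    (h0 : 0 ∈ interior B) (X : Gr 2 V) (Y : Submodule ℝ V) (hY : Module.finrank ℝ Y = 1)
    (hs : B ⊆ (B ∩ (X.1 : Set V)) + (Y : Set V)) :
    ∃ e : V, e ≠ 0 ∧ e ∉ X.1 ∧ (∀ v, v ∈ Y ↔ ∃ c : ℝ, v = c • e) ∧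
      ∀ x ∈ X.1, ∀ t : ℝ, gauge B x ≤ gauge B (x + t • e) := by
  have hn : B ∈ nhds (0:V) := mem_interior_iff_mem_nhds.1 h0
  have habs : Absorbent ℝ B := absorbent_nhds_zero hn
  obtain ⟨⟨e, heY⟩, he, hgen⟩ := finrank_eq_one_iff'.1 hY
  have he0 : e ≠ 0 := by
    intro h; apply he; exact Subtype.ext h
  have hYe : ∀ v, v ∈ Y ↔ ∃ c : ℝ, v = c • e := by
    intro v
    constructor
    · intro hv
      obtain ⟨c, hc⟩ := hgen ⟨v, hv⟩
      exact ⟨c, (congrArg Subtype.val hc).symm⟩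
    · rintro ⟨c, rfl⟩
      exact Y.smul_mem c heY
  have heX : e ∉ X.1 := by
    intro heX
    have hsub : B ⊆ (X.1 : Set V) := by
      intro v hv
      obtain ⟨b, hb, y, hy, rfl⟩ := hs hv
      obtain ⟨c, rfl⟩ := (hYe y).1 hy
      exact X.1.add_mem hb.2 (X.1.smul_mem c heX)
    have htop := Submodule.eq_top_of_nonempty_interior' X.1 ⟨0, interior_mono hsub h0⟩
    have := X.2
    rw [htop, finrank_top, hV] at this
    omega
  refine ⟨e, he0, heX, hYe, ?_⟩
  intro x hx t
  refine le_of_forall_gt_imp_ge_of_dense ?_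
  intro r hr
  obtain ⟨s, hs0, hsr, hmem⟩ := exists_lt_of_gauge_lt habs hr
  refine le_trans ?_ hsr.le
  apply gauge_le_of_mem hs0.le
  rw [Set.mem_smul_set_iff_inv_smul_mem₀ hs0.ne'] at hmem ⊢
  obtain ⟨b, hb, y, hy, hby⟩ := hs hmem
  obtain ⟨c, rfl⟩ := (hYe y).1 hy
  have hby : b + c • e = s⁻¹ • (x + t • e) := hby
  have h1 : s⁻¹ • x - b = (c - s⁻¹ * t) • e := by
    have : s⁻¹ • x = s⁻¹ • (x + t • e) - (s⁻¹ * t) • e := by module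
    rw [this, ← hby]; module
  have h2 : (c - s⁻¹ * t) • e ∈ X.1 := by
    rw [← h1]; exact X.1.sub_mem (X.1.smul_mem _ hx) hb.2
  have h3 : c - s⁻¹ * t = 0 := by
    by_contra hne
    exact heX ((X.1.smul_mem_iff hne).1 h2)
  rw [h3, zero_smul, sub_eq_zero] at h1
  rw [h1]; exact hb.1

end DC

theorem degenerate_case_3d
    {V : Type*} [NormedAddCommGroup V] [NormedSpace ℝ V] [FiniteDimensional ℝ V]
    (hV : Module.finrank ℝ V = 3)
    (B : Set V) (hB : IsConvexBody B) (h0 : 0 ∈ interior B)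
    (𝒰 : Set (Gr 2 V)) (h𝒰open : IsOpen 𝒰) (h𝒰conn : IsConnected 𝒰)
    (φ : Gr 2 V → Submodule ℝ V)
    (hφ : ∀ X ∈ 𝒰, Module.finrank ℝ (φ X) = 1 ∧
      B ⊆ (B ∩ (X.1 : Set V)) + (φ X : Set V))
    (hni : ∃ X₁ ∈ 𝒰, ∃ X₂ ∈ 𝒰, X₁ ≠ X₂ ∧ φ X₁ = φ X₂) :
    ∃ C : Set V, IsCylinder 2 C ∧
      ∀ X ∈ 𝒰, B ∩ (X.1 : Set V) = C ∩ (X.1 : Set V) := by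
  obtain ⟨X₁, hX₁, X₂, hX₂, hne, heq⟩ := hni
  have hΦ := DC_gauge hB h0
  have hn : B ∈ nhds (0:V) := mem_interior_iff_mem_nhds.1 h0
  obtain ⟨e, he0, heX₁, hYe, hD₁⟩ := DC_C1 hV hB h0 X₁ _ (hφ X₁ hX₁).1 (hφ X₁ hX₁).2
  have hD₂ : ∀ x ∈ X₂.1, ∀ t : ℝ, gauge B x ≤ gauge B (x + t • e) := by
    obtain ⟨e', he', -, hYe', hD'⟩ := DC_C1 hV hB h0 X₂ _ (hφ X₂ hX₂).1 (hφ X₂ hX₂).2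
    rw [← heq] at hYe'
    obtain ⟨c, hc⟩ := (hYe' e).1 ((hYe e).2 ⟨1, by simp⟩)
    intro x hx t
    have := hD' x hx (t * c)
    rwa [mul_smul, ← hc] at this
  have notmem : ∀ X : Gr 2 V, (∀ x ∈ X.1, ∀ t : ℝ, gauge B x ≤ gauge B (x + t • e)) → e ∉ X.1 := by
    intro X hX he
    have h1 := hX e he (-1)
    have h2 := hΦ.pos e he0
    simp at h1
    linarith
  have uniq : ∀ (X Y : Gr 2 V) (ξ : V →L[ℝ] ℝ), (∀ v, v ∈ X.1 ↔ ξ v = 0) →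
      (∀ v, v ∈ Y.1 ↔ ξ v = 0) → X = Y := by
    intro X Y ξ h1 h2
    apply Subtype.ext
    ext v
    rw [h1, h2]
  have hall : ∀ X ∈ 𝒰, ∀ x ∈ X.1, ∀ t : ℝ, gauge B x ≤ gauge B (x + t • e) := by
    have hAo : IsOpen {X | X ∈ 𝒰 ∧ ∀ x ∈ X.1, ∀ t : ℝ, gauge B x ≤ gauge B (x + t • e)} := by
      apply DC_T2 hV
      rintro X ⟨hXU, hXD⟩
      obtain ⟨f0, hf0e, hf0⟩ := DC_rep hV X (notmem X hXD)
      refine ⟨f0, e, hf0e, hf0, ?_⟩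
      obtain ⟨X', hX'ne, hX'D⟩ : ∃ X' : Gr 2 V, X ≠ X' ∧
          ∀ x ∈ X'.1, ∀ t : ℝ, gauge B x ≤ gauge B (x + t • e) := by
        by_cases h : X = X₁
        · exact ⟨X₂, h ▸ hne, hD₂⟩
        · exact ⟨X₁, h, hD₁⟩
      obtain ⟨f1, hf1e, hf1⟩ := DC_rep hV X' (notmem X' hX'D)
      have hT1 := DC_T1 hV h𝒰open hXU hf0e hf0
      have hcore := DC_core hV hΦ (f0 := f0) (f1 := f1) (e := e)
        (fun x hx t => hXD x ((hf0 x).2 hx) t) (fun x hx t => hX'D x ((hf1 x).2 hx) t) hf0e hf1e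
        (by rintro rfl; exact hX'ne (uniq _ _ _ hf0 hf1))
        (by
          filter_upwards [hT1] with ξ hξ
          obtain ⟨Y, hY, hYk⟩ := hξ
          obtain ⟨e', he', -, -, hD'⟩ := DC_C1 hV hB h0 Y _ (hφ Y hY).1 (hφ Y hY).2
          exact ⟨e', he', fun x hx t => hD' x ((hYk x).2 hx) t⟩)
      filter_upwards [hT1, hcore] with ξ h1 h2 Y hY
      obtain ⟨Z, hZ, hZk⟩ := h1
      refine ⟨uniq _ _ _ hZk hY ▸ hZ, ?_⟩
      intro x hx t
      exact h2 x ((hY x).1 hx) t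
    have hAc : IsOpen {X | X ∈ 𝒰 ∧ ¬ ∀ x ∈ X.1, ∀ t : ℝ, gauge B x ≤ gauge B (x + t • e)} := by
      apply DC_T2 hV
      rintro X ⟨hXU, hXD⟩
      push Not at hXD
      obtain ⟨x, hx, t, hxt⟩ := hXD
      obtain ⟨w, -, hwX, -, -⟩ := DC_C1 hV hB h0 X _ (hφ X hXU).1 (hφ X hXU).2
      obtain ⟨f0, hf0w, hf0⟩ := DC_rep hV X hwX
      refine ⟨f0, w, hf0w, hf0, ?_⟩
      have hT1 := DC_T1 hV h𝒰open hXU hf0w hf0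
      have ca : ∀ v : V, Continuous (fun ξ : V →L[ℝ] ℝ => ξ v) := fun v => by fun_prop
      have c1 : ∀ᶠ ξ in nhds f0, ξ w ≠ 0 :=
        ((ca w).continuousAt (x := f0)).eventually_ne (by simp [hf0w])
      have c2 : Filter.Tendsto (fun ξ : V →L[ℝ] ℝ => x - (ξ x / ξ w) • w) (nhds f0) (nhds x) := by
        have : ContinuousAt (fun ξ : V →L[ℝ] ℝ => x - (ξ x / ξ w) • w) f0 := by
          refine continuousAt_const.sub ((ContinuousAt.div (ca x).continuousAt
            (ca w).continuousAt (by simp [hf0w])).smul continuousAt_const)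
        have := this.tendsto
        simpa [(hf0 x).1 hx] using this
      have c3 : ∀ᶠ y in nhds x, gauge B (y + t • e) < gauge B y := by
        have k1 : Continuous (fun y => gauge B (y + t • e)) :=
          hΦ.cont.comp (continuous_id.add continuous_const)
        exact k1.continuousAt.eventually_lt hΦ.cont.continuousAt hxt
      filter_upwards [hT1, c1, c2.eventually c3] with ξ h1 h2 h3 Y hY
      obtain ⟨Z, hZ, hZk⟩ := h1
      refine ⟨uniq _ _ _ hZk hY ▸ hZ, ?_⟩
      push Not
      refine ⟨x - (ξ x / ξ w) • w, ?_, t, h3⟩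
      rw [hY]
      simp
      field_simp
      ring
    by_contra hcon
    push Not at hcon
    obtain ⟨X, hXU, x, hx, t, hxt⟩ := hcon
    obtain ⟨Z, -, hZ1, hZ2⟩ := h𝒰conn.isPreconnected _ _ hAo hAc
      (by
        intro Y hY
        by_cases h : ∀ x ∈ Y.1, ∀ t : ℝ, gauge B x ≤ gauge B (x + t • e)
        · exact Or.inl ⟨hY, h⟩
        · exact Or.inr ⟨hY, h⟩)
      ⟨X₁, hX₁, hX₁, hD₁⟩
      ⟨X, hXU, hXU, fun h => absurd (h x hx t) (not_le.2 hxt)⟩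
    exact hZ2.2 hZ1.2
  refine ⟨(B ∩ (X₁.1 : Set V)) + (φ X₁ : Set V), ⟨B ∩ (X₁.1 : Set V), X₁.1, X₁.2,
    Set.inter_subset_right, ?_, ?_, ?_, φ X₁, ?_, rfl⟩, ?_⟩
  · exact hB.1.inter_right X₁.1.closed_of_finiteDimensional
  · exact hB.2.1.inter X₁.1.convex
  · refine ⟨0, ?_⟩
    rw [mem_interior_iff_mem_nhds]
    have : ((↑) ⁻¹' B : Set X₁.1) ∈ nhds (0 : X₁.1) :=
      continuous_subtype_val.continuousAt.preimage_mem_nhds (by simpa using hn)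
    filter_upwards [this] with y hy
    exact ⟨hy, y.2⟩
  · obtain ⟨f, hfe, hf⟩ := DC_rep hV X₁ heX₁
    constructor
    · rw [Submodule.disjoint_def]
      intro x hx hx'
      obtain ⟨c, rfl⟩ := (hYe x).1 hx'
      have := (hf _).1 hx
      simp [hfe] at this
      simp [this]
    · rw [codisjoint_iff, eq_top_iff]
      intro v _
      rw [Submodule.mem_sup]
      refine ⟨v - f v • e, ?_, f v • e, (hYe _).2 ⟨_, rfl⟩, by simp⟩
      rw [hf]; simp [hfe]
  · intro X hX
    ext x
    constructor
    · rintro ⟨hxB, hxX⟩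
      exact ⟨(hφ X₁ hX₁).2 hxB, hxX⟩
    · rintro ⟨⟨b, hb, y, hy, hby⟩, hxX⟩
      refine ⟨?_, hxX⟩
      obtain ⟨c, rfl⟩ := (hYe y).1 hy
      have hby : b + c • e = x := hby
      have h1 := hall X hX x hxX (-c)
      have h2 : x + (-c) • e = b := by rw [← hby]; module
      rw [h2] at h1
      have h3 := h1.trans (gauge_le_one_of_mem hb.1)
      have := (gauge_le_one_iff_mem_closure hB.2.1 hn).1 h3
      rwa [hB.1.isClosed.closure_eq] at this
end

section
/- Let V be a 3-dimensional real vector space, B ⊂ V a convex body with 0 in its interior, and 𝒰 ⊂ Gr₂ V a nonempty connected open set such that for every X ∈ 𝒰 there exists a (necessarily unique) line φ(X) ∈ Gr₁ V with B ⊂ (B ∩ X) + φ(X). Let X₁, X₂, X₃ ∈ 𝒰 be three distinct planes containing a common line ℓ ∈ Gr₁ V. Then the lines φ(X₁), φ(X₂), φ(X₃) are contained in one 2-dimensional linear subspace of V. -/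
open Module Set Pointwise

section Aux
open Filter Topology

theorem aux_dense {E : Type*} [NormedAddCommGroup E] [NormedSpace ℝ E] [FiniteDimensional ℝ E]
    {f : E → ℝ} {K : NNReal} (hf : LipschitzWith K f) :
    Dense {x : E | DifferentiableAt ℝ f x} := by
  let _ : MeasurableSpace E := borel E
  have _ : BorelSpace E := ⟨rfl⟩
  let w := Basis.ofVectorSpace ℝ E
  exact MeasureTheory.Measure.dense_of_ae (hf.ae_differentiableAt (μ := w.addHaar))

theorem aux_line {E : Type*} [NormedAddCommGroup E] [NormedSpace ℝ E]
    {f : E → ℝ} {g : E →L[ℝ] ℝ} {p : E} (hf : HasFDerivAt f g p) (x : E) :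
    HasDerivAt (fun ε : ℝ => f (p + ε • x)) (g x) 0 := by
  have h1 : HasDerivAt (fun ε : ℝ => p + ε • x) x 0 := by
    simpa using ((hasDerivAt_id (0:ℝ)).smul_const x).const_add p
  have h2 : HasFDerivAt f g (p + (0:ℝ) • x) := by simpa using hf
  exact h2.comp_hasDerivAt (0:ℝ) h1

theorem aux_homog {E : Type*} [NormedAddCommGroup E] [NormedSpace ℝ E]
    {f : E → ℝ} {g : E →L[ℝ] ℝ} {p : E} (hf : HasFDerivAt f g p)
    (hh : ∀ c : ℝ, 0 ≤ c → ∀ x, f (c • x) = c * f x) : g p = f p := by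
  have h1 := aux_line hf p
  have h2 : HasDerivAt (fun ε : ℝ => (1 + ε) * f p) (f p) 0 := by
    simpa using ((hasDerivAt_id (0:ℝ)).const_add 1).mul_const (f p)
  refine h1.unique (h2.congr_of_eventuallyEq ?_)
  filter_upwards [lt_mem_nhds (show (-1:ℝ) < 0 by norm_num)] with ε hε
  rw [← hh _ (by linarith), add_smul, one_smul]

theorem aux_le {E : Type*} [NormedAddCommGroup E] [NormedSpace ℝ E]
    {f : E → ℝ} {g : E →L[ℝ] ℝ} {p : E} (hf : HasFDerivAt f g p) (x y : E)
    (h : ∀ ε : ℝ, 0 < ε → f (p + ε • x) ≤ f (p + ε • y)) : g x ≤ g y := by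
  have h1 := ((aux_line hf y).sub (aux_line hf x)).tendsto_slope_zero_right
  have : 0 ≤ g y - g x := by
    refine ge_of_tendsto h1 ?_
    filter_upwards [self_mem_nhdsWithin] with ε hε
    have h3 := h ε hε
    simp only [Pi.sub_apply, zero_add, zero_smul, add_zero, sub_self, sub_zero, smul_eq_mul]
    have : 0 < ε := hε
    have := inv_pos.2 this
    apply mul_nonneg this.le
    linarith
  linarith

def CDir {V : Type*} [NormedAddCommGroup V] [NormedSpace ℝ V] (N : V → ℝ)
    (X : Submodule ℝ V) (w : V) : Prop := ∀ x ∈ X, ∀ τ : ℝ, N x ≤ N (x + τ • w)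

theorem aux_span {V : Type*} [NormedAddCommGroup V] [NormedSpace ℝ V] [FiniteDimensional ℝ V]
    (X : Submodule ℝ V) (hX : finrank ℝ X = 2) (p t : V) (hp : p ∈ X) (ht : t ∈ X)
    (h : LinearIndependent ℝ ![p, t]) : Submodule.span ℝ {p, t} = X := by
  apply Submodule.eq_of_le_of_finrank_eq
  · rw [Submodule.span_le]; rintro x (rfl | rfl) <;> assumption
  · have := finrank_span_eq_card h
    rw [Matrix.range_cons_cons_empty, Fintype.card_fin] at this
    rw [this, hX]

theorem aux_unique {V : Type*} [NormedAddCommGroup V] [NormedSpace ℝ V] [FiniteDimensional ℝ V]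
    (hV : finrank ℝ V = 3) (N : V → ℝ) (K : NNReal) (hL : LipschitzWith K N)
    (hh : ∀ c : ℝ, 0 ≤ c → ∀ x, N (c • x) = c * N x) (hpos : ∀ x, x ≠ 0 → 0 < N x)
    (X : Submodule ℝ V) (hX : finrank ℝ X = 2)
    (hop : ∀ p t : V, LinearIndependent ℝ ![p, t] → Submodule.span ℝ {p, t} = X →
      ∀ᶠ q : V × V in 𝓝 (p, t), ∃ w, w ≠ 0 ∧ CDir N (Submodule.span ℝ {q.1, q.2}) w)
    (w w' : V) (hw0 : w ≠ 0) (hw : CDir N X w) (hw' : CDir N X w') :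
    w' ∈ Submodule.span ℝ {w} := by
  have hN0 : N 0 = 0 := by simpa using hh 0 le_rfl 0
  have hnot : ∀ z, z ≠ 0 → CDir N X z → z ∉ X := by
    intro z hz hc hzX
    have := hc z hzX (-1)
    rw [neg_one_smul, add_neg_cancel, hN0] at this
    exact absurd (hpos z hz) (not_lt.2 this)
  have hwX := hnot w hw0 hw
  -- every vector decomposes
  have hdec : ∀ z : V, ∃ x ∈ X, ∃ a : ℝ, z = x + a • w := by
    have htop : X ⊔ Submodule.span ℝ {w} = ⊤ := by
      apply Submodule.eq_top_of_finrank_eq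
      have h1 : X < X ⊔ Submodule.span ℝ {w} := by
        refine lt_of_le_of_ne le_sup_left fun h => hwX ?_
        rw [h]; exact Submodule.mem_sup_right (Submodule.mem_span_singleton_self w)
      have h2 := Submodule.finrank_lt_finrank_of_lt h1
      have h3 := Submodule.finrank_le (X ⊔ Submodule.span ℝ {w})
      omega
    intro z
    have hz : z ∈ X ⊔ Submodule.span ℝ {w} := htop ▸ Submodule.mem_top
    obtain ⟨x, hx, y, hy, rfl⟩ := Submodule.mem_sup.1 hz
    obtain ⟨a, rfl⟩ := Submodule.mem_span_singleton.1 hy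
    exact ⟨x, hx, a, rfl⟩
  -- w' = e0 + b w
  obtain ⟨e, heX, b, hw'e⟩ := hdec w'
  by_cases he0 : e = 0
  · rw [hw'e, he0, zero_add]; exact Submodule.smul_mem _ _ (Submodule.mem_span_singleton_self w)
  exfalso
  have hb : b ≠ 0 := by
    rintro rfl
    have : w' = e := by simpa using hw'e
    exact hnot w' (this ▸ he0) hw' (this ▸ heX)
  -- N (x + a b w) ≥ N (x - a e)
  have hw2 : ∀ x ∈ X, ∀ a : ℝ, N (x - a • e) ≤ N (x + (a * b) • w) := by
    intro x hx a
    have := hw' (x - a • e) (X.sub_mem hx (X.smul_mem _ heX)) a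
    rw [hw'e] at this
    convert this using 2
    module
  have hLX : LipschitzWith K (fun x : X => N x) := fun x y => hL x y
  obtain ⟨p, hpd, hpo⟩ := (aux_dense hLX).exists_mem_open
    (U := {p : X | K * ‖(⟨e, heX⟩ : X) - p‖ < N p})
    (isOpen_lt (by fun_prop) hLX.continuous) ⟨⟨e, heX⟩, by simpa using hpos e he0⟩
  have hpo' : K * ‖(⟨e, heX⟩ : X) - p‖ < N p := hpo
  obtain ⟨g, hg⟩ : DifferentiableAt ℝ (fun x : X => N x) p := hpd
  have hgK := hg.le_of_lipschitz hLX
  have hgp : g p = N p := aux_homog hg (fun c hc x => hh c hc x)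
  have hNp : 0 < N p := lt_of_le_of_lt (by positivity) hpo'
  have hge : 0 < g ⟨e, heX⟩ := by
    have h1 : g ⟨e, heX⟩ = g p + g (⟨e, heX⟩ - p) := by rw [map_sub]; ring
    have h2 := g.le_opNorm (⟨e, heX⟩ - p)
    have h3 : ‖g‖ * ‖(⟨e, heX⟩ : X) - p‖ ≤ K * ‖(⟨e, heX⟩ : X) - p‖ := by gcongr
    have h4 := neg_abs_le (g (⟨e, heX⟩ - p))
    rw [Real.norm_eq_abs] at h2
    linarith
  obtain ⟨t, htk, ht0⟩ : ∃ t : X, g t = 0 ∧ t ≠ 0 := by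
    have h1 : LinearMap.ker (g : X →ₗ[ℝ] ℝ) ≠ ⊥ :=
      LinearMap.ker_ne_bot_of_finrank_lt (by rw [hX, finrank_self]; norm_num)
    obtain ⟨t, ht, ht0⟩ := Submodule.exists_mem_ne_zero_of_ne_bot h1
    exact ⟨t, by simpa using ht, ht0⟩
  have hp0 : (p : V) ≠ 0 := by intro h; rw [h, hN0] at hNp; exact lt_irrefl _ hNp
  have hli : LinearIndependent ℝ ![(p : V), (t : V)] := by
    rw [LinearIndependent.pair_iff' hp0]
    intro a ha
    have h1 : a • p = t := Subtype.ext ha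
    have h2 : a * N p = 0 := by rw [← hgp, ← smul_eq_mul, ← map_smul, h1, htk]
    rcases mul_eq_zero.1 h2 with h | h
    · rw [h, zero_smul] at h1; exact ht0 h1.symm
    · exact hNp.ne' h
  have hev := hop p t hli (aux_span X hX p t p.2 t.2 hli)
  have hcont : Tendsto (fun s : ℝ => ((p : V), (t : V) + s • w)) (𝓝[≠] 0) (𝓝 ((p : V), (t : V))) := by
    have : Continuous (fun s : ℝ => ((p : V), (t : V) + s • w)) := by fun_prop
    have h := this.tendsto 0
    simp only [zero_smul, add_zero] at h
    exact h.mono_left nhdsWithin_le_nhds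
  have hfin : ∀ᶠ s : ℝ in 𝓝[≠] 0, N (t + s • w) ≤ N (s • w) := by
    filter_upwards [hcont.eventually hev, self_mem_nhdsWithin] with s hs hs0
    have hs0 : s ≠ 0 := hs0
    obtain ⟨v, hv0, hv⟩ := hs
    obtain ⟨x, hx, a, hvx⟩ := hdec v
    have hpm : (p : V) ∈ Submodule.span ℝ {(p : V), (t : V) + s • w} :=
      Submodule.subset_span (by simp)
    have htm : (t : V) + s • w ∈ Submodule.span ℝ {(p : V), (t : V) + s • w} :=
      Submodule.subset_span (by simp)
    have key : ∀ τ : ℝ, 0 ≤ τ * g ⟨x, hx⟩ ∧ τ * (a / b) * g ⟨e, heX⟩ ≤ τ * g ⟨x, hx⟩ := by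
      intro τ
      set d : ℝ := - τ * a / s with hd
      have hds : d * s = - τ * a := by rw [hd]; field_simp
      have hup : ∀ ε : ℝ, N (p + ε • (d • (t + s • w))) ≤
          N (p + ε • (d • (t : V) + τ • x)) := by
        intro ε
        have := hv (p + ε • (d • (t + s • w)))
          (Submodule.add_mem _ hpm (Submodule.smul_mem _ _ (Submodule.smul_mem _ _ htm))) (ε * τ)
        convert this using 2
        rw [hvx]
        have : d • s • w = - (τ • a • w) := by
          rw [smul_smul, smul_smul, hds]; module
        rw [smul_add d, this]
        module
      have r : g (d • t + τ • (⟨x, hx⟩ : X)) = τ * g ⟨x, hx⟩ := by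
        rw [map_add, map_smul, map_smul, htk]; simp
      constructor
      · have := aux_le hg (d • t) (d • t + τ • (⟨x, hx⟩ : X)) (by
          intro ε _
          refine le_trans ?_ (hup ε)
          have := hw (p + ε • d • (t : V)) (X.add_mem p.2 (X.smul_mem _ (X.smul_mem _ t.2)))
            (ε * d * s)
          refine le_of_eq_of_le (congrArg N ?_) (le_of_le_of_eq this (congrArg N ?_))
          · simp only [Submodule.coe_add, Submodule.coe_smul]
          · module)
        rw [r, map_smul, htk] at this
        simpa using this
      · have := aux_le hg (d • t + (τ * (a / b)) • (⟨e, heX⟩ : X))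
            (d • t + τ • (⟨x, hx⟩ : X)) (by
          intro ε _
          refine le_trans ?_ (hup ε)
          have := hw2 (p + ε • d • (t : V)) (X.add_mem p.2 (X.smul_mem _ (X.smul_mem _ t.2)))
            (ε * (d * s / b))
          refine le_of_eq_of_le (congrArg N ?_) (le_of_le_of_eq this (congrArg N ?_))
          · rw [hds]
            simp only [Submodule.coe_add, Submodule.coe_smul]
            module
          · rw [show ε * (d * s / b) * b = ε * d * s by field_simp]
            module)
        rw [r, map_add, map_smul, map_smul, htk] at this
        simpa using this
    have k1 := key 1
    have k2 := key (-1)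
    have hgx : g ⟨x, hx⟩ = 0 := by linarith [k1.1, k2.1]
    have hab : a / b * g ⟨e, heX⟩ = 0 := by
      rw [hgx] at k1 k2
      linarith [k1.2, k2.2]
    have ha : a = 0 := by
      rcases mul_eq_zero.1 hab with h | h
      · rcases div_eq_zero_iff.1 h with h | h
        · exact h
        · exact absurd h hb
      · exact absurd h hge.ne'
    have hvx' : v = x := by simpa [ha] using hvx
    have hx0 : x ≠ 0 := hvx' ▸ hv0
    -- t is a multiple of x
    obtain ⟨c, hc⟩ : ∃ c : ℝ, c • x = t := by
      have hgne : (g : X →ₗ[ℝ] ℝ) ≠ 0 := by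
        intro h
        have : (g : X →ₗ[ℝ] ℝ) p = 0 := by rw [h]; rfl
        exact hNp.ne' (hgp ▸ this)
      have h1 := Module.Dual.finrank_ker_add_one_of_ne_zero (f := (g : X →ₗ[ℝ] ℝ)) hgne
      rw [hX] at h1
      have h2 : finrank ℝ (LinearMap.ker (g : X →ₗ[ℝ] ℝ)) = 1 := by omega
      obtain ⟨c, hc⟩ := (finrank_eq_one_iff_of_nonzero' (⟨⟨x, hx⟩, hgx⟩ : LinearMap.ker (g : X →ₗ[ℝ] ℝ))
        (by
          intro h
          exact hx0 (congrArg (fun z : LinearMap.ker (g : X →ₗ[ℝ] ℝ) => ((z : X) : V)) h))).1 h2 ⟨t, htk⟩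
      exact ⟨c, congrArg (fun z : LinearMap.ker (g : X →ₗ[ℝ] ℝ) => ((z : X) : V)) hc⟩
    have := hv _ htm (-c)
    rw [hvx', neg_smul, hc] at this
    convert this using 2
    abel
  have hNc := hL.continuous
  have l1 : Tendsto (fun s : ℝ => N (t + s • w)) (𝓝[≠] 0) (𝓝 (N t)) := by
    have : Continuous (fun s : ℝ => N (t + s • w)) := by fun_prop
    have h := this.tendsto 0
    simp only [zero_smul, add_zero] at h
    exact h.mono_left nhdsWithin_le_nhds
  have l2 : Tendsto (fun s : ℝ => N (s • w)) (𝓝[≠] 0) (𝓝 0) := by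
    have : Continuous (fun s : ℝ => N (s • w)) := by fun_prop
    have h := this.tendsto 0
    simp only [zero_smul, hN0] at h
    exact h.mono_left nhdsWithin_le_nhds
  have := le_of_tendsto_of_tendsto l1 l2 hfin
  exact absurd (hpos t (by simpa using ht0)) (not_lt.2 this)

theorem aux_cdir {V : Type*} [NormedAddCommGroup V] [NormedSpace ℝ V] [FiniteDimensional ℝ V]
    (hV : finrank ℝ V = 3) (B : Set V) (h0 : B ∈ 𝓝 (0 : V)) (X Y : Submodule ℝ V)
    (hX : finrank ℝ X = 2) (hY : finrank ℝ Y = 1)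
    (h : B ⊆ (B ∩ (X : Set V)) + (Y : Set V)) (w : V) (hw : w ∈ Y) : CDir (gauge B) X w := by
  have htop : X ⊔ Y = ⊤ := by
    apply Submodule.eq_top_of_nonempty_interior'
    refine ⟨0, mem_interior_iff_mem_nhds.2 (mem_of_superset h0 fun v hv => ?_)⟩
    obtain ⟨x, hx, y, hy, rfl⟩ := h hv
    exact Submodule.add_mem_sup hx.2 hy
  have hbot : X ⊓ Y = ⊥ := by
    have := Submodule.finrank_sup_add_finrank_inf_eq X Y
    rw [htop, finrank_top, hV, hX, hY] at this
    exact Submodule.finrank_eq_zero.1 (by omega)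
  intro x hx τ
  refine le_of_forall_gt_imp_ge_of_dense fun r hr => ?_
  obtain ⟨c, hc, hcr, hm⟩ := exists_lt_of_gauge_lt (absorbent_nhds_zero h0) hr
  obtain ⟨v, hv, hvx⟩ := hm
  obtain ⟨x', hx', y, hy, rfl⟩ := h hv
  have hz : x - c • x' ∈ X ⊓ Y := by
    refine ⟨X.sub_mem hx (X.smul_mem _ hx'.2), ?_⟩
    have : x - c • x' = c • y - τ • w := by
      simp only [smul_add] at hvx
      rw [sub_eq_sub_iff_add_eq_add, ← hvx]; abel
    rw [this]
    exact Y.sub_mem (Y.smul_mem _ hy) (Y.smul_mem _ hw)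
  rw [hbot, Submodule.mem_bot, sub_eq_zero] at hz
  refine le_trans (gauge_le_of_mem hc.le ?_) hcr.le
  rw [hz]
  exact smul_mem_smul_set hx'.1

theorem aux_exists_basis {V : Type*} [NormedAddCommGroup V] [NormedSpace ℝ V]
    [FiniteDimensional ℝ V]
    (X : Submodule ℝ V) (hX : finrank ℝ X = 2) (p : V) (hp0 : p ≠ 0) :
    ∃ t ∈ X, LinearIndependent ℝ ![p, t] := by
  by_contra hcon
  push Not at hcon
  have : X ≤ Submodule.span ℝ {p} := by
    intro t ht
    have h := hcon t ht
    rw [LinearIndependent.pair_iff' hp0] at h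
    push Not at h
    exact Submodule.mem_span_singleton.2 h
  have h1 := Submodule.finrank_mono this
  rw [finrank_span_singleton hp0] at h1
  omega

theorem aux_limit {V : Type*} [NormedAddCommGroup V] [NormedSpace ℝ V] [FiniteDimensional ℝ V]
    (N : V → ℝ) (K : NNReal) (hL : LipschitzWith K N)
    (hh : ∀ c : ℝ, 0 ≤ c → ∀ x, N (c • x) = c * N x)
    (v : V) (u : Fin 3 → V)
    (hev : ∀ i, ∀ᶠ q : V × V in 𝓝 (v, u i),
      ∃ w, w ≠ 0 ∧ CDir N (Submodule.span ℝ {q.1, q.2}) w) :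
    ∃ f : V →L[ℝ] ℝ, f v = N v ∧
      ∀ i, ∃ w, w ≠ 0 ∧ f w = 0 ∧ CDir N (Submodule.span ℝ {v, u i}) w := by
  set l : Filter V := 𝓝[{x : V | DifferentiableAt ℝ N x}] v with hl
  have hne : l.NeBot := mem_closure_iff_nhdsWithin_neBot.1 (aux_dense hL v)
  set S : Set ((V →L[ℝ] ℝ) × (Fin 3 → V)) :=
    Metric.closedBall 0 K ×ˢ Set.pi Set.univ (fun _ => Metric.sphere 0 1) with hS
  have hSc : IsCompact S :=
    (isCompact_closedBall _ _).prod (isCompact_univ_pi fun _ => isCompact_sphere _ _)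
  have h1 : ∀ᶠ q in l, ∃ z : (V →L[ℝ] ℝ) × (Fin 3 → V), z ∈ S ∧ z.1 q = N q ∧
      ∀ i, z.1 (z.2 i) = 0 ∧ CDir N (Submodule.span ℝ {q, u i}) (z.2 i) := by
    have h2 : ∀ᶠ q in l, ∀ i, ∃ w, w ≠ 0 ∧ CDir N (Submodule.span ℝ {q, u i}) w := by
      rw [eventually_all]
      intro i
      have : Tendsto (fun q : V => (q, u i)) l (𝓝 (v, u i)) := by
        have : Continuous (fun q : V => (q, u i)) := by fun_prop
        exact (this.tendsto v).mono_left nhdsWithin_le_nhds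
      exact this.eventually (hev i)
    filter_upwards [h2, self_mem_nhdsWithin] with q hq hqd
    obtain ⟨f, hf⟩ : DifferentiableAt ℝ N q := hqd
    choose w hw0 hw using hq
    have hw1 : ∀ i, CDir N (Submodule.span ℝ {q, u i}) (‖w i‖⁻¹ • w i) := by
      intro i x hx τ
      rw [smul_smul]
      exact hw i x hx _
    refine ⟨(f, fun i => ‖w i‖⁻¹ • w i), ⟨?_, ?_⟩, aux_homog hf hh, fun i => ⟨?_, hw1 i⟩⟩
    · simpa using hf.le_of_lipschitz hL
    · intro i _
      simp [norm_smul, hw0 i]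
    · have hqm : q ∈ Submodule.span ℝ {q, u i} := Submodule.subset_span (by simp)
      have a1 := aux_le hf 0 (‖w i‖⁻¹ • w i) (fun ε _ => by
        simpa using hw1 i q hqm ε)
      have a2 := aux_le hf 0 (-(‖w i‖⁻¹ • w i)) (fun ε _ => by
        simpa using hw1 i q hqm (-ε))
      rw [map_zero] at a1 a2
      rw [map_neg] at a2
      change f (‖w i‖⁻¹ • w i) = 0
      linarith
  obtain ⟨F, hF⟩ := h1.choice
  set U : Ultrafilter V := Ultrafilter.of l with hU
  have hUl : (U : Filter V) ≤ l := Ultrafilter.of_le l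
  have hFU := hUl hF
  have hFU : ∀ᶠ q in (U : Filter V), F q ∈ S ∧ (F q).1 q = N q ∧
      ∀ i, (F q).1 ((F q).2 i) = 0 ∧ CDir N (Submodule.span ℝ {q, u i}) ((F q).2 i) := hFU
  obtain ⟨z, hzS, hz⟩ := hSc.ultrafilter_le_nhds (U.map F) (by
    rw [le_principal_iff]
    exact hFU.mono fun q hq => hq.1)
  have hz : Tendsto F U (𝓝 z) := hz
  have hid : Tendsto (fun q : V => q) U (𝓝 v) := hUl.trans nhdsWithin_le_nhds
  have hz1 : Tendsto (fun q => (F q).1) U (𝓝 z.1) := (continuous_fst.tendsto z).comp hz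
  have hz2 : ∀ i, Tendsto (fun q => (F q).2 i) U (𝓝 (z.2 i)) := fun i =>
    (((continuous_apply i).comp continuous_snd).tendsto z).comp hz
  have hNc := hL.continuous
  have happ : ∀ {G : V → V} {y : V}, Tendsto G U (𝓝 y) →
      Tendsto (fun q => (F q).1 (G q)) U (𝓝 (z.1 y)) := by
    intro G y hG
    have hc : Continuous (fun r : (V →L[ℝ] ℝ) × V => r.1 r.2) := by fun_prop
    exact (hc.tendsto (z.1, y)).comp (hz1.prodMk_nhds hG)
  refine ⟨z.1, ?_, fun i => ⟨z.2 i, ?_, ?_, ?_⟩⟩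
  · refine tendsto_nhds_unique (happ hid) (((hNc.tendsto v).comp hid).congr' ?_)
    exact hFU.mono fun q hq => hq.2.1.symm
  · have : ‖z.2 i‖ = 1 := by simpa using hzS.2 i (Set.mem_univ i)
    intro h
    rw [h, norm_zero] at this
    exact zero_ne_one this
  · refine tendsto_nhds_unique (happ (hz2 i)) (tendsto_const_nhds.congr' ?_)
    exact hFU.mono fun q hq => (hq.2.2 i).1.symm
  · intro x hx τ
    obtain ⟨a, b, rfl⟩ := Submodule.mem_span_pair.1 hx
    have t0 : Tendsto (fun q : V => a • q + b • u i) U (𝓝 (a • v + b • u i)) :=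
      (hid.const_smul a).add_const _
    have t1 := (hNc.tendsto _).comp t0
    have t2 := (hNc.tendsto _).comp (t0.add ((hz2 i).const_smul τ))
    refine le_of_tendsto_of_tendsto t1 t2 ?_
    filter_upwards [hFU] with q hq
    exact (hq.2.2 i).2 _ (Submodule.mem_span_pair.2 ⟨a, b, rfl⟩) τ

theorem aux_open {V : Type*} [NormedAddCommGroup V] [NormedSpace ℝ V] [FiniteDimensional ℝ V]
    (𝒰 : Set (Gr 2 V)) (ho : IsOpen 𝒰) (Q : Submodule ℝ V → Prop) (hQ : ∀ X ∈ 𝒰, Q X.1)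
    (X : Gr 2 V) (hX : X ∈ 𝒰) (p t : V) (hli : LinearIndependent ℝ ![p, t])
    (hs : Submodule.span ℝ {p, t} = X.1) :
    ∀ᶠ q : V × V in 𝓝 (p, t), Q (Submodule.span ℝ {q.1, q.2}) := by
  have h1 := isOpen_coinduced.1 ho
  have h2 := (isOpen_setOfPred_linearIndependent (𝕜 := ℝ) (E := V)
    (ι := Fin 2)).isOpenMap_subtype_val _ h1
  have hc : Continuous (fun q : V × V => ![q.1, q.2]) := by
    refine continuous_pi fun i => ?_
    fin_cases i
    · exact continuous_fst
    · exact continuous_snd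
  have h3 := (h2.preimage hc).mem_nhds (x := (p, t)) (by
    refine ⟨⟨![p, t], hli⟩, ?_, rfl⟩
    rw [Set.mem_preimage]
    convert hX using 1
    apply Subtype.ext
    rw [← hs]
    simp only [Matrix.range_cons_cons_empty])
  filter_upwards [h3] with q hq
  obtain ⟨⟨r, hr⟩, hr1, hr2⟩ := hq
  have := hQ _ hr1
  have hr2 : r = ![q.1, q.2] := hr2
  simp only [hr2, Matrix.range_cons_cons_empty] at this
  exact this

end Aux

/-- **Collinearity.** If three distinct planes `X₁, X₂, X₃ ∈ 𝒰` contain a common line,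
then the lines `φ X₁, φ X₂, φ X₃` lie in one 2-dimensional subspace. -/
theorem collinearity_3d
    {V : Type*} [NormedAddCommGroup V] [NormedSpace ℝ V] [FiniteDimensional ℝ V]
    (hV : Module.finrank ℝ V = 3)
    (B : Set V) (hB : IsConvexBody B) (h0 : 0 ∈ interior B)
    (𝒰 : Set (Gr 2 V)) (h𝒰open : IsOpen 𝒰) (h𝒰conn : IsConnected 𝒰)
    (φ : Gr 2 V → Submodule ℝ V)
    (hφ : ∀ X ∈ 𝒰, Module.finrank ℝ (φ X) = 1 ∧
      B ⊆ (B ∩ (X.1 : Set V)) + (φ X : Set V))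
    (X₁ X₂ X₃ : Gr 2 V) (hX₁ : X₁ ∈ 𝒰) (hX₂ : X₂ ∈ 𝒰) (hX₃ : X₃ ∈ 𝒰)
    (h12 : X₁ ≠ X₂) (h13 : X₁ ≠ X₃) (h23 : X₂ ≠ X₃)
    (ℓ : Submodule ℝ V) (hℓ : Module.finrank ℝ ℓ = 1)
    (hℓ₁ : ℓ ≤ X₁.1) (hℓ₂ : ℓ ≤ X₂.1) (hℓ₃ : ℓ ≤ X₃.1) :
    ∃ P : Submodule ℝ V, Module.finrank ℝ P = 2 ∧
      φ X₁ ≤ P ∧ φ X₂ ≤ P ∧ φ X₃ ≤ P := by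
  obtain ⟨hBc, hBconv, -⟩ := hB
  have h0' : B ∈ nhds (0 : V) := mem_interior_iff_mem_nhds.1 h0
  obtain ⟨K, hL⟩ := hBconv.lipschitz_gauge h0'
  have hh : ∀ c : ℝ, 0 ≤ c → ∀ x, gauge B (c • x) = c * gauge B x := fun c hc x => by
    rw [gauge_smul_of_nonneg hc, smul_eq_mul]
  have hpos : ∀ x, x ≠ 0 → 0 < gauge B x := fun x hx =>
    (gauge_pos (absorbent_nhds_zero h0')
      ((NormedSpace.isVonNBounded_iff ℝ).2 hBc.isBounded)).2 hx
  have hcd : ∀ X ∈ 𝒰, ∀ w ∈ φ X, CDir (gauge B) X.1 w := fun X hX w hw =>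
    aux_cdir hV B h0' X.1 (φ X) X.2 (hφ X hX).1 (hφ X hX).2 w hw
  have hex : ∀ X ∈ 𝒰, ∃ w, w ≠ 0 ∧ CDir (gauge B) X.1 w := by
    intro X hX
    have : φ X ≠ ⊥ := by
      intro h
      have h1 := (hφ X hX).1
      rw [h, finrank_bot] at h1
      exact zero_ne_one h1
    obtain ⟨w, hw, hw0⟩ := Submodule.exists_mem_ne_zero_of_ne_bot this
    exact ⟨w, hw0, hcd X hX w hw⟩
  have hop := aux_open 𝒰 h𝒰open (fun X => ∃ w, w ≠ 0 ∧ CDir (gauge B) X w) hex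
  obtain ⟨v, hvℓ, hv0⟩ : ∃ v ∈ ℓ, v ≠ 0 := by
    apply Submodule.exists_mem_ne_zero_of_ne_bot
    intro h
    rw [h, finrank_bot] at hℓ
    exact zero_ne_one hℓ
  let X : Fin 3 → Gr 2 V := ![X₁, X₂, X₃]
  have hX : ∀ i, X i ∈ 𝒰 := by intro i; fin_cases i <;> assumption
  have hvX : ∀ i, v ∈ (X i).1 := by
    intro i
    fin_cases i
    · exact hℓ₁ hvℓ
    · exact hℓ₂ hvℓ
    · exact hℓ₃ hvℓ
  choose u huX hu using fun i => aux_exists_basis (X i).1 (X i).2 v hv0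
  have hsp : ∀ i, Submodule.span ℝ {v, u i} = (X i).1 := fun i =>
    aux_span _ (X i).2 v (u i) (hvX i) (huX i) (hu i)
  obtain ⟨f, hfv, hf⟩ := aux_limit (gauge B) K hL hh v u
    (fun i => hop (X i) (hX i) v (u i) (hu i) (hsp i))
  have hfin : ∀ i, φ (X i) ≤ LinearMap.ker (f : V →ₗ[ℝ] ℝ) := by
    intro i w' hw'
    obtain ⟨w, hw0, hfw, hw⟩ := hf i
    rw [hsp i] at hw
    have := aux_unique hV (gauge B) K hL hh hpos (X i).1 (X i).2 (hop (X i) (hX i)) w w' hw0 hw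
      (hcd _ (hX i) w' hw')
    obtain ⟨c, rfl⟩ := Submodule.mem_span_singleton.1 this
    exact Submodule.smul_mem _ _ hfw
  refine ⟨LinearMap.ker (f : V →ₗ[ℝ] ℝ), ?_, hfin 0, hfin 1, hfin 2⟩
  have hne : (f : V →ₗ[ℝ] ℝ) ≠ 0 := by
    intro h
    have h1 : (f : V →ₗ[ℝ] ℝ) v = 0 := by rw [h]; rfl
    have h2 : f v = 0 := h1
    exact (hpos v hv0).ne' (hfv ▸ h2)
  have h1 := Module.Dual.finrank_ker_add_one_of_ne_zero (f := (f : V →ₗ[ℝ] ℝ)) hne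
  omega
end
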